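/- arXiv:1902.07157 — 6 statements merged into one kernel-verified Lean document; each statement's English description precedes it below -/
import Mathlib

section
/- If m is not principal, then E/R is a simple R-module, where E = End_R(m) is viewed as the ring {α ∈ K : α·m ⊆ m} between R and its integral closure in the fraction field K. -/
universe u

/-- `R` has injective dimension at most one over itself; for a one-dimensional Noetherian
local ring this is exactly the Gorenstein condition. -/
def InjDimLEOne (R : Type u) [CommRing R] : Prop :=
  ∃ (I₀ I₁ : Type u) (_ : AddCommGroup I₀) (_ : Module R I₀) (_ : AddCommGroup I₁)
    (_ : Module R I₁), Module.Injective R I₀ ∧ Module.Injective R I₁ ∧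
    ∃ (f : R →ₗ[R] I₀) (g : I₀ →ₗ[R] I₁),
      Function.Injective f ∧ Function.Surjective g ∧ LinearMap.range f = LinearMap.ker g

variable (R : Type u) [CommRing R] [IsDomain R] [IsLocalRing R]

/-- The image of the maximal ideal of `R` in the fraction field `K`. -/
def mK : Submodule R (FractionRing R) :=
  Submodule.map (Algebra.linearMap R (FractionRing R)) (IsLocalRing.maximalIdeal R)

/-- `E = {α ∈ K : α·m ⊆ m}`, the endomorphism ring of the maximal ideal, viewed as a subring
of the fraction field `K` containing `R`. -/
def endE : Subalgebra R (FractionRing R) where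
  carrier := {α : FractionRing R | ∀ x ∈ mK R, α * x ∈ mK R}
  add_mem' := fun {a b} ha hb x hx => by
    simpa [add_mul] using (mK R).add_mem (ha x hx) (hb x hx)
  mul_mem' := fun {a b} ha hb x hx => by
    simpa [mul_assoc] using ha _ (hb x hx)
  one_mem' := fun x hx => by simpa using hx
  algebraMap_mem' := fun r x hx => by
    simpa [Algebra.smul_def] using (mK R).smul_mem r hx

/-- A linear map into an injective module factors through any linear map with smaller kernel. -/
theorem Module.Injective.exists_comp_eq_of_ker_le {A : Type u} [Ring A] {M N I : Type u}
    [AddCommGroup M] [AddCommGroup N] [AddCommGroup I] [Module A M] [Module A N] [Module A I]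
    (hI : Module.Injective A I) (p : M →ₗ[A] N) (q : M →ₗ[A] I)
    (h : LinearMap.ker p ≤ LinearMap.ker q) : ∃ t : N →ₗ[A] I, ∀ x, t (p x) = q x := by
  obtain ⟨t, ht⟩ := hI.out ((LinearMap.ker p).liftQ p le_rfl)
    (LinearMap.ker_eq_bot.1 (Submodule.ker_liftQ_eq_bot _ _ _ le_rfl))
    ((LinearMap.ker p).liftQ q h)
  exact ⟨t, fun x => by simpa using ht (Submodule.Quotient.mk x)⟩

/-- If `A` is a domain of injective dimension at most one, with fraction field `K`, then `K / A`
is injective. -/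
theorem InjDimLEOne.injective_quotient_range {A K : Type u} [CommRing A] [IsDomain A]
    [Field K] [Algebra A K] [IsFractionRing A K] (h : InjDimLEOne A) :
    Module.Injective A (K ⧸ LinearMap.range (Algebra.linearMap A K)) := by
  set N := LinearMap.range (Algebra.linearMap A K)
  obtain ⟨I₀, I₁, _, _, _, _, hI₀, hI₁, f, g, hf, hg, hfg⟩ := h
  refine Module.Baer.injective fun J φ => ?_
  let P : Submodule A (J × K) :=
    LinearMap.ker (φ ∘ₗ LinearMap.fst A J K - N.mkQ ∘ₗ LinearMap.snd A J K)
  have mem_P (j : J) (k : K) : (j, k) ∈ P ↔ φ j = N.mkQ k := by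
    simp [P, sub_eq_zero]
  have hιP (s : A) : ((0 : J), algebraMap A K s) ∈ P := by
    rw [mem_P, map_zero, eq_comm, Submodule.mkQ_apply, Submodule.Quotient.mk_eq_zero]
    exact ⟨s, rfl⟩
  let ι : A →ₗ[A] P := (LinearMap.inr A J K ∘ₗ Algebra.linearMap A K).codRestrict P hιP
  have hι : Function.Injective ι := fun a b hab =>
    IsFractionRing.injective A K (congrArg (fun z : P => z.1.2) hab)
  obtain ⟨u, hu⟩ := hI₀.out ι hι f
  let pr : P →ₗ[A] A := J.subtype ∘ₗ LinearMap.fst A J K ∘ₗ P.subtype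
  have hgf (s : A) : g (f s) = 0 := by
    have : f s ∈ LinearMap.ker g := hfg ▸ LinearMap.mem_range_self f s
    exact this
  have exists_of_fst_eq_zero (z : P) (hz : (z.1.1 : A) = 0) :
      ∃ s, algebraMap A K s = z.1.2 ∧ u z = f s := by
    obtain ⟨⟨j, k⟩, hjk⟩ := z
    obtain rfl : j = 0 := Subtype.ext hz
    have hk := (mem_P _ _).1 hjk
    rw [map_zero, eq_comm, Submodule.mkQ_apply, Submodule.Quotient.mk_eq_zero] at hk
    obtain ⟨s, rfl⟩ := hk
    exact ⟨s, rfl, hu s⟩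
  obtain ⟨t, ht⟩ := hI₁.exists_comp_eq_of_ker_le pr (g ∘ₗ u) fun z hz => by
    obtain ⟨s, -, hs⟩ := exists_of_fst_eq_zero z hz
    rw [LinearMap.mem_ker, LinearMap.comp_apply, hs, hgf]
  obtain ⟨y, hy⟩ := hg (t 1)
  have exists_sub_eq (z : P) : ∃ r, f r = u z - (z.1.1 : A) • y := by
    have : u z - (z.1.1 : A) • y ∈ LinearMap.ker g := by
      have h1 : g (u z) = (z.1.1 : A) • t 1 := by
        rw [← map_smul, smul_eq_mul, mul_one]
        exact (ht z).symm
      rw [LinearMap.mem_ker, map_sub, map_smul, hy, h1, sub_self]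
    rw [← hfg] at this
    exact this
  have exists_rep (j : J) : ∃ k, (j, k) ∈ P := by
    obtain ⟨k, hk⟩ := N.mkQ_surjective (φ j)
    exact ⟨k, (mem_P _ _).2 hk.symm⟩
  by_cases hJ : ∃ j₀ : J, (j₀ : A) ≠ 0
  · obtain ⟨j₀, hj₀⟩ := hJ
    obtain ⟨k₀, hk₀⟩ := exists_rep j₀
    obtain ⟨r₀, hr₀⟩ := exists_sub_eq ⟨_, hk₀⟩
    have hj₀' : algebraMap A K j₀ ≠ 0 := by
      simpa using hj₀
    refine ⟨LinearMap.toSpanSingleton A _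
      (N.mkQ ((k₀ - algebraMap A K r₀) / algebraMap A K j₀)), fun j hj => ?_⟩
    obtain ⟨k, hk⟩ := exists_rep ⟨j, hj⟩
    obtain ⟨r, hr⟩ := exists_sub_eq ⟨_, hk⟩
    obtain ⟨s, hs, hs'⟩ := exists_of_fst_eq_zero
      ((j₀ : A) • ⟨_, hk⟩ - j • ⟨_, hk₀⟩) (by simp [mul_comm])
    have hsr : s = j₀ * r - j * r₀ := hf <| by
      rw [← hs', map_sub, map_sub, map_smul, map_smul, ← smul_eq_mul, ← smul_eq_mul,
        map_smul, map_smul, hr, hr₀]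
      simp only [smul_sub, smul_smul, mul_comm]
      abel
    have hs2 : algebraMap A K s = algebraMap A K j₀ * k - algebraMap A K j * k₀ := by
      simpa [Algebra.smul_def] using hs
    rw [hsr, map_sub, map_mul, map_mul] at hs2
    rw [LinearMap.toSpanSingleton_apply, ← map_smul, (mem_P _ _).1 hk, Submodule.mkQ_apply,
      Submodule.mkQ_apply, eq_comm, Submodule.Quotient.eq]
    refine ⟨r, ?_⟩
    rw [Algebra.linearMap_apply, Algebra.smul_def]
    field_simp
    linear_combination hs2
  · push Not at hJ
    refine ⟨0, fun j hj => ?_⟩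
    obtain rfl : j = 0 := hJ ⟨j, hj⟩
    exact (map_zero φ).symm

/-- In a one-dimensional Noetherian local domain that is not a field, the inverse of the maximal
ideal is strictly larger than the ring. -/
theorem exists_fractionRing_mul_maximalIdeal_subset [IsNoetherianRing R]
    (hdim : ringKrullDim R = 1) (hm : IsLocalRing.maximalIdeal R ≠ ⊥) :
    ∃ α : FractionRing R, (∀ r, algebraMap R (FractionRing R) r ≠ α) ∧
      ∀ z ∈ IsLocalRing.maximalIdeal R, ∃ r, algebraMap R (FractionRing R) r =
        α * algebraMap R (FractionRing R) z := by
  obtain ⟨x, hxm, hx⟩ := Submodule.exists_mem_ne_zero_of_ne_bot hm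
  have : Ring.KrullDimLE 1 R := Ring.krullDimLE_iff.2 hdim.le
  have : Nontrivial (R ⧸ Ideal.span {x}) :=
    Ideal.Quotient.nontrivial_iff.2 fun h =>
      (IsLocalRing.mem_maximalIdeal x).1 hxm (Ideal.span_singleton_eq_top.1 h)
  obtain ⟨p, hp⟩ := associatedPrimes.nonempty R (R ⧸ Ideal.span {x})
  obtain ⟨hp, b, hb⟩ := isAssociatedPrime_iff.1 hp
  obtain ⟨a, rfl⟩ := Ideal.Quotient.mk_surjective b
  have mem_p (z : R) : z ∈ p ↔ x ∣ z * a := by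
    rw [hb, Submodule.mem_colon_singleton, Submodule.mem_bot, ← Ideal.mem_span_singleton,
      ← Ideal.Quotient.eq_zero_iff_mem]
    rfl
  have hpm : p = IsLocalRing.maximalIdeal R := by
    have hxp : x ∈ p := (mem_p x).2 (dvd_mul_right x a)
    have : p ≠ ⊥ := fun h => hx (by simpa [h] using hxp)
    exact IsLocalRing.eq_maximalIdeal (hp.isMaximal_of_ne_bot this)
  have hx' : algebraMap R (FractionRing R) x ≠ 0 := by simpa using hx
  refine ⟨algebraMap R _ a / algebraMap R _ x, fun r hr => ?_, fun z hz => ?_⟩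
  · refine hp.ne_top ((Ideal.eq_top_iff_one p).2 ((mem_p 1).2 ⟨r, ?_⟩))
    rw [eq_div_iff hx'] at hr
    apply IsFractionRing.injective R (FractionRing R)
    rw [one_mul, map_mul, ← hr, mul_comm]
  · obtain ⟨r, hr⟩ := (mem_p z).1 (hpm ▸ hz)
    have := congrArg (algebraMap R (FractionRing R)) hr
    rw [map_mul, map_mul] at this
    refine ⟨r, ?_⟩
    field_simp
    linear_combination -this

/-- If the maximal ideal `m` is not principal, the fractions mapping `m` into the ring map `m`
into itself. -/
theorem mem_endE_of_mul_maximalIdeal_subset {A : Type u} [CommRing A]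
    [IsLocalRing A] (hnp : ¬ (IsLocalRing.maximalIdeal A).IsPrincipal)
    {α : FractionRing A}
    (h : ∀ z ∈ IsLocalRing.maximalIdeal A, ∃ r, algebraMap A (FractionRing A) r =
      α * algebraMap A (FractionRing A) z) : α ∈ endE A := by
  rintro _ ⟨z, hz, rfl⟩
  obtain ⟨r, hr⟩ := h z hz
  refine ⟨r, ?_, hr⟩
  by_contra hrm
  obtain ⟨v, rfl⟩ : IsUnit r := by simpa using hrm
  refine hnp ⟨z, le_antisymm (fun w hw => ?_) ?_⟩
  · obtain ⟨s, hs⟩ := h w hw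
    refine Submodule.mem_span_singleton.2 ⟨s * ↑v⁻¹,
      IsFractionRing.injective A (FractionRing A) ?_⟩
    have hv : algebraMap A (FractionRing A) ↑v⁻¹ * algebraMap A (FractionRing A) ↑v = 1 := by
      rw [← map_mul, Units.inv_mul, map_one]
    rw [smul_eq_mul, map_mul, map_mul, hs]
    rw [hr] at hv
    linear_combination algebraMap A (FractionRing A) w * hv
  · simpa [Ideal.span_singleton_le_iff_mem] using hz

/-- Modulo `R`, any element of `E` outside `R` generates `E`. -/
theorem exists_sub_smul_mem_range (hGor : InjDimLEOne R)
    (hm : IsLocalRing.maximalIdeal R ≠ ⊥) {α β : FractionRing R} (hα : α ∈ endE R)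
    (hβ : β ∈ endE R) (hαR : α ∉ LinearMap.range (Algebra.linearMap R (FractionRing R))) :
    ∃ r : R, r • α - β ∈ LinearMap.range (Algebra.linearMap R (FractionRing R)) := by
  set N := LinearMap.range (Algebra.linearMap R (FractionRing R))
  have hmN {γ : FractionRing R} (hγ : γ ∈ endE R) {z : R}
      (hz : z ∈ IsLocalRing.maximalIdeal R) : z • γ ∈ N := by
    obtain ⟨w, -, hw⟩ := hγ _ (Submodule.mem_map_of_mem hz)
    exact ⟨w, by rw [hw, Algebra.smul_def, mul_comm]; rfl⟩
  obtain ⟨t, ht⟩ := hGor.injective_quotient_range.exists_comp_eq_of_ker_le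
    (LinearMap.toSpanSingleton R _ (N.mkQ α)) (LinearMap.toSpanSingleton R _ (N.mkQ β))
    fun z hz => by
      rw [LinearMap.mem_ker, LinearMap.toSpanSingleton_apply, ← map_smul, Submodule.mkQ_apply,
        Submodule.Quotient.mk_eq_zero] at hz ⊢
      refine hmN hβ ?_
      by_contra hzm
      obtain ⟨v, rfl⟩ : IsUnit z := by simpa using hzm
      exact hαR (by simpa [smul_smul] using N.smul_mem (↑v⁻¹ : R) hz)
  obtain ⟨x, hxm, hx⟩ := Submodule.exists_mem_ne_zero_of_ne_bot hm
  have hx' : algebraMap R (FractionRing R) x ≠ 0 := by simpa using hx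
  obtain ⟨γ, hγ⟩ := N.mkQ_surjective (t (N.mkQ (algebraMap R (FractionRing R) x)⁻¹))
  have hxγ : x • γ ∈ N := by
    rw [← Submodule.Quotient.mk_eq_zero, ← Submodule.mkQ_apply, map_smul, hγ, ← map_smul,
      ← map_smul, Algebra.smul_def, mul_inv_cancel₀ hx',
      show N.mkQ (1 : FractionRing R) = 0 from
        (Submodule.Quotient.mk_eq_zero N).2 ⟨1, (algebraMap R (FractionRing R)).map_one⟩,
      map_zero]
  obtain ⟨c, hc⟩ := hxγ
  obtain ⟨a, ha⟩ := hmN hα hxm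
  rw [Algebra.linearMap_apply, Algebra.smul_def] at hc ha
  refine ⟨c, (Submodule.Quotient.eq N).1 ?_⟩
  have h1 : a • (algebraMap R (FractionRing R) x)⁻¹ = α := by
    rw [Algebra.smul_def, ha]
    field_simp
  have h2 : c • α = a • γ := by
    rw [Algebra.smul_def, Algebra.smul_def, hc, ha]
    ring
  have h3 := ht 1
  rw [LinearMap.toSpanSingleton_apply, LinearMap.toSpanSingleton_apply, one_smul, one_smul] at h3
  rw [← Submodule.mkQ_apply, ← Submodule.mkQ_apply, ← h3, h2, map_smul, hγ, ← map_smul,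
    ← map_smul, h1]

/-- If `m` is not principal, then `E/R` is a simple `R`-module. -/
theorem stmt3 [IsNoetherianRing R] (hdim : ringKrullDim R = 1) (hGor : InjDimLEOne R)
    (hnp : ¬ (IsLocalRing.maximalIdeal R).IsPrincipal) :
    IsSimpleModule R
      ((endE R) ⧸ ((LinearMap.range (Algebra.linearMap R (FractionRing R))).comap
        (Subalgebra.toSubmodule (endE R)).subtype)) := by
  have hm : IsLocalRing.maximalIdeal R ≠ ⊥ := fun h => hnp (h ▸ bot_isPrincipal)
  rw [isSimpleModule_iff_toSpanSingleton_surjective]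
  constructor
  · obtain ⟨α, hαR, hα⟩ := exists_fractionRing_mul_maximalIdeal_subset R hdim hm
    refine Submodule.Quotient.nontrivial_iff.2 fun h => ?_
    obtain ⟨r, hr⟩ := Submodule.eq_top_iff'.1 h
      ⟨α, mem_endE_of_mul_maximalIdeal_subset hnp hα⟩
    exact hαR r hr
  · intro a ha b
    obtain ⟨⟨α, hα⟩, rfl⟩ := Submodule.Quotient.mk_surjective _ a
    obtain ⟨⟨β, hβ⟩, rfl⟩ := Submodule.Quotient.mk_surjective _ b
    obtain ⟨r, hr⟩ := exists_sub_smul_mem_range R hGor hm hα hβ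
      fun h => ha ((Submodule.Quotient.mk_eq_zero _).2 h)
    refine ⟨r, ?_⟩
    rw [LinearMap.toSpanSingleton_apply, ← Submodule.Quotient.mk_smul, Submodule.Quotient.eq]
    exact hr
end

section
/- If m is not principal, then E is minimally generated as an R-module by {1, y}, where y is any element of E not in R; in particular E is generated by two elements as an R-module and dim_k(E/mE) = 2. -/
set_option synthInstance.maxHeartbeats 1000000

universe u

variable (R : Type u) [CommRing R] [IsDomain R] [IsLocalRing R]

open IsLocalRing

variable {R}

/-- If `m` is not principal, then `(R : m) ⊆ E`. -/
theorem mem_endE_of_mul_mem_range (hnp : ¬ (maximalIdeal R).IsPrincipal) {y : FractionRing R}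
    (hy : ∀ r ∈ maximalIdeal R, ∃ s : R, algebraMap R (FractionRing R) s =
      y * algebraMap R (FractionRing R) r) :
    y ∈ endE R := by
  rintro _ ⟨r, hr, rfl⟩
  obtain ⟨s, hs⟩ := hy r hr
  refine ⟨s, ?_, hs⟩
  by_contra hsm
  have hu : IsUnit s := not_not.mp hsm
  obtain ⟨u, rfl⟩ := hu
  refine hnp ⟨r, le_antisymm (fun t ht => ?_) ?_⟩
  · obtain ⟨v, hv⟩ := hy t ht
    refine Ideal.mem_span_singleton'.mpr ⟨v * ↑u⁻¹, ?_⟩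
    have h : v * r = t * u := by
      apply IsFractionRing.injective R (FractionRing R)
      rw [map_mul, map_mul, hv, hs]
      ring
    rw [mul_right_comm, h, mul_assoc, Units.mul_inv, mul_one]
  · exact (Ideal.span_singleton_le_iff_mem _).mpr hr

theorem exists_mem_endE_notMem_range [IsNoetherianRing R] [Ring.KrullDimLE 1 R]
    (hnp : ¬ (maximalIdeal R).IsPrincipal) :
    ∃ y ∈ endE R, y ∉ LinearMap.range (Algebra.linearMap R (FractionRing R)) := by
  have hbot : maximalIdeal R ≠ ⊥ := fun h => hnp (h ▸ inferInstance)
  obtain ⟨x, hx, hx0⟩ := Submodule.exists_mem_ne_zero_of_ne_bot hbot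
  have : Nontrivial (R ⧸ Ideal.span {x}) := Ideal.Quotient.nontrivial_iff.mpr
    (ne_top_of_le_ne_top (maximalIdeal.isMaximal R).ne_top
      ((Ideal.span_singleton_le_iff_mem _).mpr hx))
  obtain ⟨p, hp⟩ := associatedPrimes.nonempty R (R ⧸ Ideal.span {x})
  obtain ⟨hprime, b', hb⟩ := isAssociatedPrime_iff.mp hp
  obtain ⟨b, rfl⟩ := Ideal.Quotient.mk_surjective b'
  have hmem : ∀ r, r ∈ p ↔ ∃ a, a * x = r * b := by
    intro r
    rw [hb, Submodule.mem_colon_singleton, Submodule.mem_bot, ← Ideal.mem_span_singleton',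
      ← Ideal.Quotient.eq_zero_iff_mem, map_mul]
    rfl
  have hpm : p = maximalIdeal R := eq_maximalIdeal <|
    hprime.isMaximal_of_ne_bot fun h => hx0 <| by
      simpa [h] using (hmem x).mpr ⟨b, mul_comm _ _⟩
  have hxK : algebraMap R (FractionRing R) x ≠ 0 := by simpa using hx0
  refine ⟨algebraMap R _ b / algebraMap R _ x, mem_endE_of_mul_mem_range hnp fun r hr => ?_, ?_⟩
  · obtain ⟨a, ha⟩ := (hmem r).mp (hpm ▸ hr)
    refine ⟨a, ?_⟩
    rw [div_mul_eq_mul_div, eq_div_iff hxK, ← map_mul, ← map_mul, ha, mul_comm]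
  · rintro ⟨c, hc⟩
    refine hprime.one_notMem ((hmem 1).mpr ⟨c, ?_⟩)
    apply IsFractionRing.injective R (FractionRing R)
    rw [Algebra.linearMap_apply, eq_div_iff hxK] at hc
    rw [one_mul, map_mul, hc]

theorem exists_algebraMap_eq_mul {α : FractionRing R} (hα : α ∈ endE R) {r : R}
    (hr : r ∈ maximalIdeal R) :
    ∃ s : R, algebraMap R (FractionRing R) s = α * algebraMap R (FractionRing R) r := by
  obtain ⟨s, -, hs⟩ := hα _ ⟨r, hr, rfl⟩
  exact ⟨s, hs⟩

/-- The socle of `K / R` is generated by any of its nonzero elements when `R` has injective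
dimension at most one. -/
theorem InjDimLEOne.exists_eq_mul_add (hGor : InjDimLEOne R) (hbot : maximalIdeal R ≠ ⊥)
    {y α : FractionRing R} (hy : y ∈ endE R)
    (hyR : y ∉ LinearMap.range (Algebra.linearMap R (FractionRing R))) (hα : α ∈ endE R) :
    ∃ c d : R, α = algebraMap R _ c * y + algebraMap R _ d := by
  obtain ⟨I₀, I₁, _, _, _, _, hI₀, hI₁, f, g, hf, hg, hfg⟩ := hGor
  have hgf : ∀ r, g (f r) = 0 := fun r => by
    rw [← LinearMap.mem_ker, ← hfg]
    exact ⟨r, rfl⟩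
  obtain ⟨x, hx, hx0⟩ := Submodule.exists_mem_ne_zero_of_ne_bot hbot
  have hxK : algebraMap R (FractionRing R) x ≠ 0 := by simpa using hx0
  obtain ⟨ι, hι⟩ := hI₀.out (Algebra.linearMap R (FractionRing R))
    (IsFractionRing.injective R (FractionRing R)) f
  set N := LinearMap.range (Algebra.linearMap R (FractionRing R)) with hN
  have hker : maximalIdeal R ≤ LinearMap.ker (LinearMap.toSpanSingleton R _ (N.mkQ y)) := by
    intro r hr
    obtain ⟨s, hs⟩ := exists_algebraMap_eq_mul hy hr
    rw [LinearMap.mem_ker, LinearMap.toSpanSingleton_apply, ← map_smul, Submodule.mkQ_apply,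
      Submodule.Quotient.mk_eq_zero]
    exact ⟨s, by rw [Algebra.linearMap_apply, hs, Algebra.smul_def, mul_comm]⟩
  let φ : (R ⧸ maximalIdeal R) →ₗ[R] FractionRing R ⧸ N :=
    Submodule.liftQ _ (LinearMap.toSpanSingleton R _ (N.mkQ y)) hker
  let ψ : (R ⧸ maximalIdeal R) →ₗ[R] I₁ :=
    Submodule.liftQ _ (LinearMap.toSpanSingleton R _ (g (ι α))) fun r hr => by
      obtain ⟨s, hs⟩ := exists_algebraMap_eq_mul hα hr
      rw [LinearMap.mem_ker, LinearMap.toSpanSingleton_apply, ← map_smul, ← map_smul,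
        Algebra.smul_def, mul_comm, ← hs, ← Algebra.linearMap_apply, hι, hgf]
  have hφ : Function.Injective φ := by
    rw [← LinearMap.ker_eq_bot, Submodule.ker_liftQ_eq_bot']
    refine le_antisymm hker fun r hr => ?_
    by_contra hrm
    obtain ⟨u, rfl⟩ : IsUnit r := not_not.mp hrm
    rw [LinearMap.mem_ker, LinearMap.toSpanSingleton_apply, ← map_smul, Submodule.mkQ_apply,
      Submodule.Quotient.mk_eq_zero] at hr
    have := N.smul_mem (↑u⁻¹ : R) hr
    rw [smul_smul, Units.inv_mul, one_smul] at this
    exact hyR this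
  obtain ⟨h, hh⟩ := hI₁.out φ hφ ψ
  have hhy : h (N.mkQ y) = g (ι α) := by
    have h1 := hh (Submodule.Quotient.mk 1)
    rwa [Submodule.liftQ_apply, Submodule.liftQ_apply, LinearMap.toSpanSingleton_apply,
      LinearMap.toSpanSingleton_apply, one_smul, one_smul] at h1
  obtain ⟨w, hw⟩ := hg (h (N.mkQ (algebraMap R _ x)⁻¹))
  obtain ⟨a, ha⟩ := exists_algebraMap_eq_mul hα hx
  obtain ⟨b, hb⟩ := exists_algebraMap_eq_mul hy hx
  have hxw : x • w ∈ LinearMap.range f := by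
    rw [hfg, LinearMap.mem_ker, map_smul, hw, ← map_smul, ← map_smul, Algebra.smul_def,
      mul_inv_cancel₀ hxK]
    convert map_zero h
    rw [Submodule.mkQ_apply, Submodule.Quotient.mk_eq_zero]
    exact ⟨1, map_one (algebraMap R _)⟩
  have hbw : ι α - b • w ∈ LinearMap.range f := by
    rw [hfg, LinearMap.mem_ker, map_sub, map_smul, hw, ← map_smul, ← map_smul, Algebra.smul_def,
      hb, mul_assoc, mul_inv_cancel₀ hxK, mul_one, hhy, sub_self]
  obtain ⟨c, hc⟩ := hxw
  obtain ⟨d, hd⟩ := hbw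
  have key : a = c * b + d * x := by
    apply hf
    have h1 : f a = x • ι α := by
      rw [← hι, Algebra.linearMap_apply, ha, ← map_smul, Algebra.smul_def, mul_comm]
    have h2 : f (c * b) = b • x • w := by rw [hc.symm, ← map_smul, smul_eq_mul, mul_comm]
    have h3 : f (d * x) = x • (ι α - b • w) := by
      rw [← hd, ← map_smul, smul_eq_mul, mul_comm]
    rw [map_add, h1, h2, h3, smul_sub, smul_comm b x w, add_sub_cancel]
  refine ⟨c, d, mul_right_cancel₀ hxK ?_⟩
  rw [← ha, key, map_add, map_mul, map_mul, hb]
  ring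

theorem span_singleton_ne_endE {y : FractionRing R} (hy : y ∈ endE R)
    (hyR : y ∉ LinearMap.range (Algebra.linearMap R (FractionRing R))) (z : FractionRing R) :
    Submodule.span R {z} ≠ Subalgebra.toSubmodule (endE R) := by
  intro hz
  have hmem : ∀ w ∈ endE R, ∃ r : R, r • z = w := fun w hw =>
    Submodule.mem_span_singleton.mp (hz ▸ (Subalgebra.mem_toSubmodule (endE R)).mpr hw)
  have hzE : z ∈ endE R :=
    (Subalgebra.mem_toSubmodule (endE R)).mp (hz ▸ Submodule.mem_span_singleton_self z)
  obtain ⟨r, hr⟩ := hmem 1 (one_mem _)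
  obtain ⟨s, hs⟩ := hmem (z * z) (mul_mem hzE hzE)
  have hz0 : z ≠ 0 := by
    rintro rfl
    simp at hr
  rw [Algebra.smul_def] at hs
  have hsz := mul_right_cancel₀ hz0 hs
  obtain ⟨t, ht⟩ := hmem y hy
  exact hyR ⟨t * s, by rw [Algebra.linearMap_apply, map_mul, hsz, ← Algebra.smul_def, ht]⟩

variable (R)

/-- If `m` is not principal, then `E` is minimally generated as an `R`-module by
`{1, y}` for any `y ∈ E \ R`; in particular `E` is two-generated and `dim_k (E/mE) = 2`. -/
theorem stmt4 [IsNoetherianRing R] (hdim : ringKrullDim R = 1) (hGor : InjDimLEOne R)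
    (hnp : ¬ (IsLocalRing.maximalIdeal R).IsPrincipal) :
    (∀ y : FractionRing R, y ∈ endE R → y ∉ LinearMap.range (Algebra.linearMap R (FractionRing R)) →
      Submodule.span R {(1 : FractionRing R), y} = Subalgebra.toSubmodule (endE R)) ∧
    (∀ z : FractionRing R, Submodule.span R {z} ≠ Subalgebra.toSubmodule (endE R)) ∧
    Module.finrank (R ⧸ IsLocalRing.maximalIdeal R)
      ((endE R) ⧸ ((IsLocalRing.maximalIdeal R) • (⊤ : Submodule R (endE R)))) = 2 := by
  have : Ring.KrullDimLE 1 R := (Order.krullDimLE_iff _ _).mpr hdim.le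
  have hbot : maximalIdeal R ≠ ⊥ := fun h => hnp (h ▸ inferInstance)
  have hspan : ∀ y : FractionRing R, y ∈ endE R →
      y ∉ LinearMap.range (Algebra.linearMap R (FractionRing R)) →
      Submodule.span R {(1 : FractionRing R), y} = Subalgebra.toSubmodule (endE R) := by
    intro y hy hyR
    refine le_antisymm (Submodule.span_le.mpr ?_) fun α hα => ?_
    · rintro _ (rfl | rfl)
      exacts [one_mem (endE R), hy]
    · obtain ⟨c, d, rfl⟩ := hGor.exists_eq_mul_add hbot hy hyR hα
      exact Submodule.mem_span_pair.mpr ⟨d, c, by simp [Algebra.smul_def, add_comm]⟩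
  obtain ⟨y, hy, hyR⟩ := exists_mem_endE_notMem_range hnp
  have hcyc := span_singleton_ne_endE hy hyR
  refine ⟨hspan, hcyc, ?_⟩
  have hfg : (Subalgebra.toSubmodule (endE R)).FG :=
    hspan y hy hyR ▸ Submodule.fg_span (Set.toFinite _)
  refine (spanFinrank_eq_finrank_quotient (Subalgebra.toSubmodule (endE R)) hfg).symm.trans ?_
  have hle : (Subalgebra.toSubmodule (endE R)).spanFinrank ≤ 2 := by
    rw [← hspan y hy hyR]
    exact (Submodule.spanFinrank_span_le_ncard_of_finite (Set.toFinite _)).trans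
      ((Set.ncard_insert_le _ _).trans (by rw [Set.ncard_singleton]))
  have h0 : (Subalgebra.toSubmodule (endE R)).spanFinrank ≠ 0 := fun h => by
    rw [Submodule.spanFinrank_eq_zero_iff_eq_bot hfg] at h
    exact hcyc 0 (by rw [h, Submodule.span_zero_singleton])
  have h1 : (Subalgebra.toSubmodule (endE R)).spanFinrank ≠ 1 := fun h => by
    obtain ⟨z, hz⟩ := ((Submodule.spanFinrank_eq_one_iff _).mp h).1
    exact hcyc z hz.symm
  lia
end

section
/- If M is a finitely generated torsion-free R-module with no nonzero free direct summand, then M* = Hom_R(M, R) equals Hom_R(M, m), and hence M* carries a natural module structure over E = End_R(m) extending its R-module structure. -/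
set_option synthInstance.maxHeartbeats 1000000

universe u

variable (R : Type u) [CommRing R] [IsDomain R] [IsLocalRing R]

/-- A linear functional that takes a unit value splits off a free rank-one
direct summand. -/
theorem exists_isCompl_of_isUnit_apply {A M : Type*} [CommRing A] [AddCommGroup M] [Module A M]
    (f : M →ₗ[A] A) (x : M) (hx : IsUnit (f x)) :
    ∃ N P : Submodule A M, IsCompl N P ∧ Nonempty (N ≃ₗ[A] A) := by
  obtain ⟨u, hu⟩ := hx
  let g : A →ₗ[A] M := LinearMap.toSpanSingleton A M ((↑u⁻¹ : A) • x)
  have hfg : f ∘ₗ g = LinearMap.id := by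
    ext
    simp [g, ← hu]
  have hg : Function.LeftInverse f g := fun a => LinearMap.congr_fun hfg a
  refine ⟨LinearMap.range g, LinearMap.ker f, ⟨?_, ?_⟩, ⟨?_⟩⟩
  · rw [Submodule.disjoint_def]
    rintro _ ⟨a, rfl⟩ ha
    rw [LinearMap.mem_ker, hg a] at ha
    rw [ha, map_zero]
  · rw [codisjoint_iff, eq_top_iff]
    intro y _
    refine Submodule.mem_sup.mpr ⟨g (f y), ⟨f y, rfl⟩, y - g (f y), ?_, add_sub_cancel _ _⟩
    rw [LinearMap.mem_ker, map_sub, hg, sub_self]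
  · exact (LinearEquiv.ofInjective g hg.injective).symm

/-- Multiplying a functional with values in the maximal ideal by an element of `endE R` gives
again a functional. -/
theorem exists_algebraMap_apply_eq_endE_mul {M : Type*} [AddCommGroup M] [Module R M]
    (a : endE R) (f : M →ₗ[R] R) (hf : ∀ x, f x ∈ IsLocalRing.maximalIdeal R) :
    ∃ g : M →ₗ[R] R, ∀ x, algebraMap R (FractionRing R) (g x) =
      (a : FractionRing R) * algebraMap R (FractionRing R) (f x) := by
  have key (x : M) : ∃ r : R, algebraMap R (FractionRing R) r =
      (a : FractionRing R) * algebraMap R (FractionRing R) (f x) := by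
    obtain ⟨r, -, hr⟩ := a.2 _ (Submodule.mem_map_of_mem (hf x))
    exact ⟨r, hr⟩
  choose g hg using key
  have hinj := IsFractionRing.injective R (FractionRing R)
  refine ⟨⟨⟨g, fun x y => hinj ?_⟩, fun r x => hinj ?_⟩, hg⟩
  · simp only [map_add, hg, mul_add]
  · simp only [map_smul, smul_eq_mul, map_mul, hg, RingHom.id_apply]
    ring

/-- Over a one-dimensional Noetherian local domain `(R, m, k)`, if `M` is a
finitely generated torsion-free `R`-module with no nonzero free direct summand, then every
`R`-linear map `M → R` has image in `m` (so `M* = Hom_R(M, m)`), and hence `M*` carries a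
module structure over `E = End_R(m)` extending its `R`-module structure. -/
theorem stmt9 [IsNoetherianRing R] (hdim : ringKrullDim R = 1)
    (M : Type u) [AddCommGroup M] [Module R M] [Module.Finite R M]
    (htf : ∀ (r : R) (x : M), r • x = 0 → r = 0 ∨ x = 0)
    (hM : ¬ ∃ (N P : Submodule R M), IsCompl N P ∧ Nonempty (N ≃ₗ[R] R)) :
    (∀ (f : M →ₗ[R] R) (x : M), f x ∈ IsLocalRing.maximalIdeal R) ∧
    ∃ _inst : Module (endE R) (M →ₗ[R] R),
      ∀ (r : R) (f : M →ₗ[R] R),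
        (algebraMap R (endE R) r) • f = r • f := by
  have hm (f : M →ₗ[R] R) (x : M) : f x ∈ IsLocalRing.maximalIdeal R := fun hu =>
    hM (exists_isCompl_of_isUnit_apply f x hu)
  refine ⟨hm, ?_⟩
  choose s hs using fun (a : endE R) (f : M →ₗ[R] R) =>
    exists_algebraMap_apply_eq_endE_mul R a f (hm f)
  have hinj := IsFractionRing.injective R (FractionRing R)
  let φ : (M →ₗ[R] R) →+ (M → FractionRing R) :=
    { toFun := fun f x => algebraMap R (FractionRing R) (f x)
      map_zero' := by ext; simp
      map_add' := fun f g => by ext; simp }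
  have hφ : Function.Injective φ := fun f g h =>
    LinearMap.ext fun x => hinj (congrFun h x)
  let _ : SMul (endE R) (M →ₗ[R] R) := ⟨s⟩
  refine ⟨hφ.module (endE R) φ fun a f => funext (hs a f), fun r f => ?_⟩
  refine LinearMap.ext fun x => hinj ((hs _ f x).trans ?_)
  simp
end

section
/- If e ∈ A = E/mE is an idempotent with 1 - e not a unit, and M is a faithful finitely generated E-module, then e·(M/mM) ≠ 0. -/
set_option synthInstance.maxHeartbeats 1000000

universe u

variable (R : Type u) [CommRing R] [IsDomain R] [IsLocalRing R]

/-- If multiplication by `a` maps a finite faithful module `M` into `I • M`, then some power of `a`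
lies in `I`. -/
theorem exists_pow_mem_of_forall_smul_mem {S M : Type*} [CommRing S] [AddCommGroup M] [Module S M]
    [Module.Finite S M] [FaithfulSMul S M] (I : Ideal S) (a : S)
    (h : ∀ x : M, a • x ∈ I • (⊤ : Submodule S M)) : ∃ n : ℕ, a ^ n ∈ I := by
  obtain ⟨p, hp, -, hc, h0⟩ :=
    LinearMap.exists_monic_and_natDegree_eq_and_coeff_mem_pow_and_aeval_eq_zero S
      (algebraMap S (Module.End S M) a) I (by rintro _ ⟨x, rfl⟩; exact h x)
  have hpa : p.eval a = 0 := by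
    rw [Polynomial.aeval_algebraMap_apply] at h0
    refine FaithfulSMul.eq_of_smul_eq_smul (α := M) fun x => ?_
    simpa using LinearMap.congr_fun h0 x
  refine ⟨p.natDegree, ?_⟩
  rw [Polynomial.eval_eq_sum_range, Finset.sum_range_succ, hp.coeff_natDegree, one_mul] at hpa
  rw [eq_neg_of_add_eq_zero_right hpa]
  refine I.neg_mem (I.sum_mem fun i hi => I.mul_mem_right _ ?_)
  exact Ideal.pow_le_self (Nat.sub_ne_zero_of_lt (Finset.mem_range.mp hi)) (hc i)

/-- Let `(R, m, k)` be a one-dimensional Gorenstein local domain,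
`E = End_R(m)` a module-finite extension of `R` inside the fraction field, `A = E/mE`, and
`M` a faithful finitely generated `E`-module.  If `e ∈ A` is an idempotent with `1 - e` not a
unit, then `e·(M/mM) ≠ 0` (where `e` acts via any lift to `E`). -/
theorem stmt12 [IsNoetherianRing R] (hdim : ringKrullDim R = 1) (hGor : InjDimLEOne R)
    (hE : Module.Finite R (endE R))
    (M : Type u) [AddCommGroup M] [Module (endE R) M] [Module.Finite (endE R) M]
    [FaithfulSMul (endE R) M]
    (e : (endE R) ⧸ ((IsLocalRing.maximalIdeal R).map (algebraMap R (endE R))))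
    (he : IsIdempotentElem e) (hu : ¬ IsUnit (1 - e)) :
    ∀ et : endE R,
      Ideal.Quotient.mk ((IsLocalRing.maximalIdeal R).map (algebraMap R (endE R))) et = e →
      ∃ x : M, et • x ∉
        (((IsLocalRing.maximalIdeal R).map (algebraMap R (endE R))) •
          (⊤ : Submodule (endE R) M)) := by
  rintro et rfl
  by_contra! h
  obtain ⟨n, hn⟩ := exists_pow_mem_of_forall_smul_mem _ et h
  rw [← Ideal.Quotient.eq_zero_iff_mem, map_pow] at hn
  have h0 := he.pow_succ_eq n
  rw [pow_succ, hn, zero_mul] at h0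
  exact hu (by rw [← h0, sub_zero]; exact isUnit_one)
end

section
/- Suppose there exist finitely generated R-modules M and N, neither of them free, such that M ⊗_R N is torsion-free. Then E = End_R(m) is a local ring and the inclusion R → E induces an isomorphism on residue fields. -/
set_option synthInstance.maxHeartbeats 1000000

universe u

variable (R : Type u) [CommRing R] [IsDomain R] [IsLocalRing R]

open IsLocalRing TensorProduct

section Lemmas

variable {R}

theorem exists_notMem_forall_mul_mem [IsNoetherianRing R] [Ring.KrullDimLE 1 R] {I : Ideal R}
    (hbot : I ≠ ⊥) (htop : I ≠ ⊤) :
    ∃ r ∉ I, ∀ t ∈ maximalIdeal R, t * r ∈ I := by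
  have : Nontrivial (R ⧸ I) := Ideal.Quotient.nontrivial_iff.2 htop
  obtain ⟨P, hP⟩ := associatedPrimes.nonempty R (R ⧸ I)
  obtain ⟨hPprime, y, hy⟩ := Submodule.isAssociatedPrime_iff.1 hP
  obtain ⟨r, rfl⟩ := Ideal.Quotient.mk_surjective y
  have hmem (t : R) : t ∈ P ↔ t * r ∈ I := by
    rw [hy, Submodule.mem_colon_singleton, Submodule.mem_bot, Algebra.smul_def,
      Ideal.Quotient.algebraMap_eq, ← map_mul, Ideal.Quotient.eq_zero_iff_mem]
  have hPbot : P ≠ ⊥ := fun h => hbot <| eq_bot_iff.2 fun t ht =>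
    h ▸ (hmem t).2 (I.mul_mem_right r ht)
  have hPmax : P = maximalIdeal R := eq_maximalIdeal (hPprime.isMaximal_of_ne_bot hPbot)
  refine ⟨r, fun hr => hPprime.ne_top ((Ideal.eq_top_iff_one _).2 ((hmem 1).2 (by simpa))), ?_⟩
  exact fun t ht => (hmem t).1 (hPmax ▸ ht)

theorem exists_forall_mul_eq {A L : Type*} [CommRing A] [IsDomain A] [AddCommGroup L] [Module A L]
    {d : A} (hd : d ≠ 0) (g : L →ₗ[A] A) (h : ∀ z, d ∣ g z) : ∃ v : L →ₗ[A] A, ∀ z, d * v z = g z := by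
  choose v hv using h
  refine ⟨⟨⟨v, fun x y => mul_left_cancel₀ hd ?_⟩, fun r x => mul_left_cancel₀ hd ?_⟩,
    fun z => (hv z).symm⟩
  · rw [mul_add, ← hv, ← hv, ← hv, map_add]
  · simp only [RingHom.id_apply, smul_eq_mul]
    rw [mul_left_comm, ← hv, ← hv, map_smul, smul_eq_mul]

theorem exists_injective_pi (A L : Type*) [CommRing A] [IsDomain A] [AddCommGroup L] [Module A L] [Module.Finite A L]
    [Module.IsTorsionFree A L] :
    ∃ (ι : Type) (_ : Fintype ι) (i : L →ₗ[A] (ι → A)), Function.Injective i := by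
  classical
  obtain ⟨n, s, hs⟩ := Module.Finite.exists_fin (R := A) (M := L)
  obtain ⟨I, hI, hmax⟩ := exists_maximal_linearIndepOn A s
  have hex (i : Fin n) : ∃ a : A, a ≠ 0 ∧ a • s i ∈ Submodule.span A (s '' I) := by
    by_cases hi : i ∈ I
    · exact ⟨1, one_ne_zero, (one_smul A (s i)).symm ▸ Submodule.subset_span (Set.mem_image_of_mem s hi)⟩
    · exact hmax i hi
  choose a ha hmem using hex
  have hA : ∏ i, a i ≠ 0 := Finset.prod_ne_zero_iff.2 fun i _ => ha i
  have hspan (x : L) : (∏ i, a i) • x ∈ Submodule.span A (Set.range fun i : I => s i) := by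
    rw [← Set.image_eq_range]
    have hx : x ∈ Submodule.span A (Set.range s) := hs ▸ Submodule.mem_top
    induction hx using Submodule.span_induction with
    | mem x hx =>
      obtain ⟨i, rfl⟩ := hx
      rw [← Finset.prod_erase_mul _ _ (Finset.mem_univ i), mul_smul]
      exact Submodule.smul_mem _ _ (hmem i)
    | zero => simp
    | add x y _ _ hx hy => rw [smul_add]; exact add_mem hx hy
    | smul r x _ hx => rw [smul_comm]; exact Submodule.smul_mem _ _ hx
  refine ⟨I, inferInstance, (Module.Basis.span hI).equivFun.toLinearMap ∘ₗ
    (LinearMap.lsmul A L (∏ i, a i)).codRestrict _ hspan, ?_⟩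
  refine fun x y hxy => ?_
  replace hxy := (Module.Basis.span hI).equivFun.injective hxy
  exact smul_right_injective L hA (congrArg Subtype.val hxy)

theorem InjDimLEOne.mem_range_of_extends [IsNoetherianRing R] [Ring.KrullDimLE 1 R]
    (hm : maximalIdeal R ≠ ⊥) (hGor : InjDimLEOne R)
    {A L : Type u} [AddCommGroup A] [Module R A] [AddCommGroup L] [Module R L]
    [Module.Finite R L] [Module.IsTorsionFree R L] (j : A →ₗ[R] L)
    (hext : ∀ p : A →ₗ[R] R, ∃ v : L →ₗ[R] R, v ∘ₗ j = p)
    {x : L} (hx : ∀ t ∈ maximalIdeal R, t • x ∈ LinearMap.range j) :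
    x ∈ LinearMap.range j := by
  by_contra hxj
  obtain ⟨I₀, I₁, _, _, _, _, hI₀, hI₁, f, g, hf, hg, hfg⟩ := hGor
  have hgf (y : R) : g (f y) = 0 := by
    rw [← LinearMap.mem_ker, ← hfg]; exact ⟨y, rfl⟩
  obtain ⟨a, ham, ha⟩ := (Submodule.ne_bot_iff _).1 hm
  obtain ⟨b, hb, hmb⟩ := exists_notMem_forall_mul_mem (I := Ideal.span {a})
    (by simpa using ha) (fun h => (mem_maximalIdeal a).1 ham (Ideal.span_singleton_eq_top.1 h))
  -- an element of `I₀` on which the maximal ideal acts through `b / a`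
  obtain ⟨h, hh⟩ := hI₀.out (LinearMap.mulLeft R a)
    (fun y z hyz => mul_left_cancel₀ ha hyz) f
  have hu (t : R) (ht : t ∈ maximalIdeal R) : t • g (h b) = 0 := by
    obtain ⟨y, hy⟩ := Ideal.mem_span_singleton.1 (hmb t ht)
    rw [← map_smul, ← map_smul, smul_eq_mul, hy, ← LinearMap.mulLeft_apply R, hh, hgf]
  -- a map `L → I₁` that kills `range j` and sends `x` to `g (h b)`
  have hker : LinearMap.ker (LinearMap.toSpanSingleton R (L ⧸ LinearMap.range j)
      (Submodule.Quotient.mk x)) = maximalIdeal R := by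
    symm
    refine (maximalIdeal.isMaximal R).eq_of_le ?_ fun t ht => ?_
    · intro h1
      have h2 : (1 : R) ∈ LinearMap.ker (LinearMap.toSpanSingleton R (L ⧸ LinearMap.range j)
        (Submodule.Quotient.mk x)) := by rw [h1]; trivial
      simp only [LinearMap.mem_ker, LinearMap.toSpanSingleton_apply, one_smul] at h2
      exact hxj ((Submodule.Quotient.mk_eq_zero _).1 h2)
    · rw [LinearMap.mem_ker, LinearMap.toSpanSingleton_apply, ← Submodule.Quotient.mk_smul,
        Submodule.Quotient.mk_eq_zero]
      exact hx t ht
  obtain ⟨w, hw⟩ := hI₁.out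
    ((maximalIdeal R).liftQ (LinearMap.toSpanSingleton R (L ⧸ LinearMap.range j)
      (Submodule.Quotient.mk x)) hker.ge)
    (LinearMap.ker_eq_bot.1 (Submodule.ker_liftQ_eq_bot _ _ _ hker.le))
    ((maximalIdeal R).liftQ (LinearMap.toSpanSingleton R I₁ (g (h b))) fun t ht => hu t ht)
  have hwx : w (Submodule.Quotient.mk x) = g (h b) := by
    have := hw (Submodule.Quotient.mk 1)
    rw [Submodule.liftQ_apply, LinearMap.toSpanSingleton_apply, one_smul] at this
    exact this.trans (one_smul R (g (h b)))
  -- a lift of that map to `I₀`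
  obtain ⟨ι, _, i, hi⟩ := exists_injective_pi R L
  obtain ⟨w', hw'⟩ := hI₁.out i hi (w ∘ₗ (LinearMap.range j).mkQ)
  obtain ⟨W, hW⟩ := Module.projective_lifting_property g w' hg
  have hWj (y : A) : W (i (j y)) ∈ LinearMap.range f := by
    rw [hfg, LinearMap.mem_ker, ← LinearMap.comp_apply, hW, hw', LinearMap.comp_apply,
      Submodule.mkQ_apply, (Submodule.Quotient.mk_eq_zero _).2 (LinearMap.mem_range_self j y),
      map_zero]
  obtain ⟨v, hv⟩ := hext ((LinearEquiv.ofInjective f hf).symm.toLinearMap ∘ₗ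
    (W ∘ₗ i ∘ₗ j).codRestrict _ hWj)
  have hvj (y : A) : f (v (j y)) = W (i (j y)) := by
    have := congrArg (fun q => f (q y)) hv
    simp only [LinearMap.comp_apply, LinearEquiv.coe_coe] at this
    rw [this, ← LinearEquiv.ofInjective_apply (h := hf), LinearEquiv.apply_symm_apply]
    rfl
  have hs : h b - (W (i x) - f (v x)) ∈ LinearMap.range f := by
    rw [hfg, LinearMap.mem_ker, map_sub, map_sub, hgf, ← LinearMap.comp_apply g W, hW, hw',
      LinearMap.comp_apply, Submodule.mkQ_apply, hwx]
    simp
  obtain ⟨s, hs⟩ := hs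
  refine hb (Ideal.mem_span_singleton.2 ⟨s, hf ?_⟩)
  obtain ⟨y, hy⟩ := hx a ham
  have hay : a • (W (i x) - f (v x)) = 0 := by
    rw [smul_sub, ← map_smul, ← map_smul, ← map_smul f, ← map_smul v, ← hy, hvj, sub_self]
  rw [← smul_eq_mul, map_smul, hs, smul_sub, hay, sub_zero, ← map_smul, smul_eq_mul,
    ← LinearMap.mulLeft_apply R, hh]

theorem InjDimLEOne.exists_smul_eq_smul [IsNoetherianRing R] [Ring.KrullDimLE 1 R]
    (hm : maximalIdeal R ≠ ⊥) (hGor : InjDimLEOne R)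
    {M : Type u} [AddCommGroup M] [Module R M] [Module.Finite R M] [Module.IsTorsionFree R M]
    (hM : ∀ g : M →ₗ[R] R, ¬ Function.Surjective g) {c d : R} (hd : d ≠ 0)
    (hcd : ∀ t ∈ maximalIdeal R, d ∣ c * t) (x : M) : ∃ y : M, d • y = c • x := by
  let D := LinearMap.range (LinearMap.lsmul R M d)
  suffices h : D.comap (LinearMap.toSpanSingleton R M (c • x)) = ⊤ by
    have h1 : (1 : R) ∈ D.comap (LinearMap.toSpanSingleton R M (c • x)) := h ▸ trivial
    simpa [D] using h1
  by_contra htop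
  have hbot : D.comap (LinearMap.toSpanSingleton R M (c • x)) ≠ ⊥ :=
    (Submodule.ne_bot_iff _).2 ⟨d, ⟨c • x, rfl⟩, hd⟩
  obtain ⟨r, hr, hmr⟩ := exists_notMem_forall_mul_mem hbot htop
  let L := D ⊔ Submodule.span R {r • c • x}
  have hDL : D ≤ L := le_sup_left
  have hxL : r • c • x ∈ L := Submodule.mem_sup_right (Submodule.mem_span_singleton_self _)
  let j : M →ₗ[R] L := (LinearMap.lsmul R M d).codRestrict L fun y => hDL ⟨y, rfl⟩
  have hgm (g : M →ₗ[R] R) (y : M) : g y ∈ maximalIdeal R := by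
    refine (mem_maximalIdeal _).2 fun hu => hM g fun s => ?_
    exact ⟨(s * hu.unit⁻¹.val) • y, by simp [mul_assoc]⟩
  obtain ⟨y, hy⟩ := hGor.mem_range_of_extends hm j
    (fun p => by
      obtain ⟨v, hv⟩ := exists_forall_mul_eq hd (p ∘ₗ L.subtype) fun z => by
        have hle : L ≤ Submodule.comap p (Ideal.span {d}) := by
          refine sup_le ?_ ?_
          · rintro _ ⟨y, rfl⟩
            simp [Ideal.mem_span_singleton]
          · rw [Submodule.span_singleton_le_iff_mem, Submodule.mem_comap, map_smul, map_smul]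
            exact Ideal.mul_mem_left _ _ (Ideal.mem_span_singleton.2 (hcd _ (hgm p x)))
        exact Ideal.mem_span_singleton.1 (hle z.2)
      refine ⟨v, LinearMap.ext fun y => mul_left_cancel₀ hd ?_⟩
      rw [LinearMap.comp_apply, hv]
      simp [j])
    (x := ⟨r • c • x, hxL⟩)
    (fun t ht => by
      obtain ⟨y, hy⟩ := hmr t ht
      refine ⟨y, Subtype.ext ?_⟩
      simpa [j, mul_smul] using hy)
  exact hr ⟨y, congrArg Subtype.val hy⟩

theorem exists_residueField_apply_eq_one_of_notMem {A M : Type*} [CommRing A] [IsLocalRing A]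
    [AddCommGroup M] [Module A M]
    {x : M} (hx : x ∉ maximalIdeal A • (⊤ : Submodule A M)) :
    ∃ φ : M →ₗ[A] ResidueField A, φ x = 1 := by
  let _ : Module (ResidueField A) (M ⧸ maximalIdeal A • (⊤ : Submodule A M)) :=
    inferInstanceAs (Module (A ⧸ maximalIdeal A) (M ⧸ maximalIdeal A • (⊤ : Submodule A M)))
  have : IsScalarTower A (ResidueField A) (M ⧸ maximalIdeal A • (⊤ : Submodule A M)) :=
    inferInstanceAs (IsScalarTower A (A ⧸ maximalIdeal A)
      (M ⧸ maximalIdeal A • (⊤ : Submodule A M)))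
  have hq := mt (Submodule.Quotient.mk_eq_zero _).1 hx
  obtain ⟨φ, hφ⟩ := not_forall.1 (mt (Module.forall_dual_apply_eq_zero_iff (ResidueField A) _).1 hq)
  refine ⟨((φ (Submodule.Quotient.mk x))⁻¹ • φ).restrictScalars A ∘ₗ Submodule.mkQ _, ?_⟩
  exact inv_mul_cancel₀ hφ

theorem maximalIdeal_smul_top_ne_top (A M : Type*) [CommRing A] [IsLocalRing A]
    [AddCommGroup M] [Module A M]
    [Module.Finite A M] [Nontrivial M] : maximalIdeal A • (⊤ : Submodule A M) ≠ ⊤ := fun h =>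
  top_ne_bot (Submodule.eq_bot_of_le_smul_of_le_jacobson_bot _ ⊤ Module.Finite.fg_top h.ge
    (maximalIdeal_le_jacobson ⊥))

theorem exists_residueField_apply_eq_one (A M : Type*) [CommRing A] [IsLocalRing A]
    [AddCommGroup M] [Module A M]
    [Module.Finite A M] [Nontrivial M] : ∃ (φ : M →ₗ[A] ResidueField A) (x : M), φ x = 1 := by
  have h := maximalIdeal_smul_top_ne_top A M
  obtain ⟨x, hx⟩ := not_forall.1 fun hall => h (Submodule.eq_top_iff'.2 hall)
  obtain ⟨φ, hφ⟩ := exists_residueField_apply_eq_one_of_notMem hx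
  exact ⟨φ, x, hφ⟩

theorem mul_eq_of_tmul_eq {A B M N : Type*} [CommRing A] [CommRing B] [Algebra A B]
    [AddCommGroup M] [Module A M] [AddCommGroup N] [Module A N] (φ : M →ₗ[A] B) (ψ : N →ₗ[A] B)
    {x x' : M} {y y' : N} (h : x ⊗ₜ[A] y = x' ⊗ₜ[A] y') : φ x * ψ y = φ x' * ψ y' := by
  simpa using congrArg (LinearMap.mul' A B ∘ₗ TensorProduct.map φ ψ) h

theorem free_of_surjective_of_free_ker {A M : Type*} [CommRing A] [AddCommGroup M] [Module A M]
    {f : M →ₗ[A] A} {s : M} (hs : f s = 1) [Module.Free A (LinearMap.ker f)] :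
    Module.Free A M := by
  let e : (LinearMap.ker f × A) →ₗ[A] M :=
    (LinearMap.ker f).subtype.coprod (LinearMap.toSpanSingleton A M s)
  have he (p : LinearMap.ker f × A) : e p = p.1 + p.2 • s := rfl
  have hfe (p : LinearMap.ker f × A) : f (e p) = p.2 := by
    rw [he, map_add, map_smul, hs, LinearMap.mem_ker.1 p.1.2, zero_add, smul_eq_mul, mul_one]
  refine Module.Free.of_equiv (LinearEquiv.ofBijective e ⟨fun p q hpq => ?_, fun x => ?_⟩)
  · have h2 : p.2 = q.2 := by rw [← hfe, hpq, hfe]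
    rw [he, he, h2, add_left_inj] at hpq
    exact Prod.ext (Subtype.ext hpq) h2
  · exact ⟨(⟨x - f x • s, by simp [hs]⟩, f x), by simp [he]⟩

theorem exists_retract_forall_not_surjective {A : Type*} [CommRing A] [IsDomain A]
    [IsNoetherianRing A] (M : Type u) [AddCommGroup M] [Module A M]
    [Module.Finite A M] (hM : ¬ Module.Free A M) :
    ∃ (P : Type u) (_ : AddCommGroup P) (_ : Module A P) (i : P →ₗ[A] M) (π : M →ₗ[A] P),
      π ∘ₗ i = LinearMap.id ∧ Nontrivial P ∧ ∀ g : P →ₗ[A] A, ¬ Function.Surjective g := by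
  induction hn : Module.finrank A M using Nat.strong_induction_on generalizing M with
  | _ n ih =>
  by_cases hsurj : ∃ f : M →ₗ[A] A, Function.Surjective f
  · obtain ⟨f, hf⟩ := hsurj
    obtain ⟨s, hs⟩ := hf 1
    have hlt : Module.finrank A (LinearMap.ker f) < n := by
      have h1 := Submodule.finrank_quotient_add_finrank (LinearMap.ker f)
      rw [(f.quotKerEquivOfSurjective hf).finrank_eq, Module.finrank_self] at h1
      omega
    obtain ⟨P, _, _, i, π, hπ, hP⟩ := ih _ hlt (LinearMap.ker f)
      (fun h => hM (free_of_surjective_of_free_ker hs)) rfl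
    let q : M →ₗ[A] LinearMap.ker f :=
      (LinearMap.id - LinearMap.toSpanSingleton A M s ∘ₗ f).codRestrict _ fun x => by simp [hs]
    refine ⟨P, _, _, (LinearMap.ker f).subtype ∘ₗ i, π ∘ₗ q, ?_, hP⟩
    have hq : q ∘ₗ (LinearMap.ker f).subtype = LinearMap.id := by
      ext x
      simp [q]
    rw [LinearMap.comp_assoc, ← LinearMap.comp_assoc i, hq, LinearMap.id_comp, hπ]
  · refine ⟨M, _, _, LinearMap.id, LinearMap.id, rfl, ?_, fun g hg => hsurj ⟨g, hg⟩⟩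
    exact not_subsingleton_iff_nontrivial.1 fun h => hM inferInstance

theorem isTorsionFree_of_retract {A M P : Type*} [CommRing A] [AddCommGroup M] [Module A M]
    [AddCommGroup P] [Module A P] [Module.IsTorsionFree A M] {i : P →ₗ[A] M} {π : M →ₗ[A] P}
    (h : π ∘ₗ i = LinearMap.id) : Module.IsTorsionFree A P :=
  (LinearMap.injective_of_comp_eq_id i π h).moduleIsTorsionFree i (map_smul i)

theorem eq_zero_of_mem_torsion_tensor {A M N : Type*} [CommRing A] [IsDomain A] [AddCommGroup M]
    [Module A M] [AddCommGroup N] [Module A N] [Module.IsTorsionFree A (M ⊗[A] N)]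
    (z : Submodule.torsion A M ⊗[A] N) :
    (Submodule.torsion A M).subtype.rTensor N z = 0 := by
  induction z using TensorProduct.induction_on with
  | zero => simp
  | add x y hx hy => rw [map_add, hx, hy, add_zero]
  | tmul x y =>
    obtain ⟨a, ha⟩ := (Submodule.mem_torsion_iff _).1 x.2
    have h : (a : A) • ((x : M) ⊗ₜ[A] y) = 0 := by
      rw [smul_tmul', show (a : A) • (x : M) = 0 from ha, zero_tmul]
    exact (smul_eq_zero.1 h).resolve_left (nonZeroDivisors.coe_ne_zero a)

theorem exists_reduction_of_isTorsionFree_tensor [IsNoetherianRing R] {M : Type u}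
    [AddCommGroup M] [Module R M] [Module.Finite R M] (hM : ¬ Module.Free R M) (N : Type u)
    [AddCommGroup N] [Module R N] [Module.Finite R N] [Nontrivial N]
    [Module.IsTorsionFree R (M ⊗[R] N)] :
    ∃ (P : Type u) (_ : AddCommGroup P) (_ : Module R P), Module.Finite R P ∧
      Module.IsTorsionFree R P ∧ Nontrivial P ∧ Module.IsTorsionFree R (P ⊗[R] N) ∧
      ∀ g : P →ₗ[R] R, ¬ Function.Surjective g := by
  let T := Submodule.torsion R M
  have hzero : T.subtype.rTensor N = 0 := LinearMap.ext eq_zero_of_mem_torsion_tensor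
  have hMT : ¬ Module.Free R (M ⧸ T) := by
    intro hfree
    obtain ⟨σ, hσ⟩ := T.mkQ.exists_rightInverse_of_surjective (Submodule.range_mkQ T)
    let p : M →ₗ[R] T := (LinearMap.id - σ ∘ₗ T.mkQ).codRestrict T fun x => by
      have h : T.mkQ (σ (T.mkQ x)) = T.mkQ x := LinearMap.congr_fun hσ (T.mkQ x)
      rw [← Submodule.Quotient.mk_eq_zero, ← Submodule.mkQ_apply, LinearMap.sub_apply, map_sub,
        LinearMap.comp_apply, h]
      exact sub_self _
    have hp : p ∘ₗ T.subtype = LinearMap.id := by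
      ext x
      have h : T.mkQ x = 0 := (Submodule.Quotient.mk_eq_zero T).2 x.2
      simp [p, -Submodule.mkQ_apply, h]
    have hsub : Subsingleton (T ⊗[R] N) := by
      refine subsingleton_of_forall_eq 0 fun z => ?_
      have h := LinearMap.congr_fun (LinearMap.rTensor_comp N p T.subtype) z
      rw [hp, hzero] at h
      simpa using h
    have hT : Subsingleton T := by
      by_contra hT
      rw [not_subsingleton_iff_nontrivial] at hT
      have : Module.Finite R T := Module.Finite.of_surjective p fun x =>
        ⟨x, LinearMap.congr_fun hp x⟩
      obtain ⟨φ, x, hφ⟩ := exists_residueField_apply_eq_one R T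
      obtain ⟨ψ, y, hψ⟩ := exists_residueField_apply_eq_one R N
      have h := mul_eq_of_tmul_eq φ ψ (Subsingleton.elim (x ⊗ₜ[R] y) (0 ⊗ₜ[R] y))
      simp [hφ, hψ] at h
    have hbot : T = ⊥ := (Submodule.subsingleton_iff_eq_bot).1 hT
    exact hM (Module.Free.of_equiv (Submodule.quotEquivOfEqBot T hbot))
  obtain ⟨P, _, _, i, π, hπ, hP, hsurj⟩ := exists_retract_forall_not_surjective _ hMT
  have hinj : Function.Injective (T.mkQ.rTensor N) := by
    rw [← LinearMap.ker_eq_bot, (rTensor_exact N (LinearMap.exact_subtype_mkQ T)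
      T.mkQ_surjective).linearMap_ker_eq, hzero, LinearMap.range_zero]
  let e := LinearEquiv.ofBijective (T.mkQ.rTensor N)
    ⟨hinj, LinearMap.rTensor_surjective N T.mkQ_surjective⟩
  have : Module.IsTorsionFree R ((M ⧸ T) ⊗[R] N) :=
    e.symm.injective.moduleIsTorsionFree _ (map_smul e.symm)
  have hπN : π.rTensor N ∘ₗ i.rTensor N = LinearMap.id := by
    rw [← LinearMap.rTensor_comp, hπ, LinearMap.rTensor_id]
  exact ⟨P, _, _, Module.Finite.of_surjective π (LinearMap.surjective_of_comp_eq_id i π hπ),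
    isTorsionFree_of_retract hπ, hP, isTorsionFree_of_retract hπN, hsurj⟩

theorem mem_endE_iff {A : Type*} [CommRing A] [IsLocalRing A] {e : FractionRing A} :
    e ∈ endE A ↔ ∀ t ∈ maximalIdeal A, ∃ s ∈ maximalIdeal A,
      algebraMap A (FractionRing A) s = e * algebraMap A (FractionRing A) t :=
  ⟨fun h t ht => h _ ⟨t, ht, rfl⟩, fun h => by
    rintro _ ⟨t, ht, rfl⟩
    exact h t ht⟩

theorem exists_algebraMap_mul_eq {A K : Type*} [CommRing A] [IsDomain A] [Field K] [Algebra A K]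
    [IsFractionRing A K] (e : K) :
    ∃ c d : A, d ≠ 0 ∧ algebraMap A K d * e = algebraMap A K c := by
  obtain ⟨c, d, hd, h⟩ := IsFractionRing.div_surjective (A := A) e
  have hd0 : algebraMap A K d ≠ 0 := by simpa using nonZeroDivisors.ne_zero hd
  exact ⟨c, d, nonZeroDivisors.ne_zero hd, by rw [← h, mul_div_cancel₀ _ hd0]⟩

theorem exists_algHom_endE {M : Type*} [AddCommGroup M] [Module R M] [Module.IsTorsionFree R M]
    (hM : ∀ c d : R, d ≠ 0 → (∀ t ∈ maximalIdeal R, d ∣ c * t) → ∀ x : M, ∃ y, d • y = c • x) :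
    ∃ ρ : endE R →ₐ[R] Module.End R M, ∀ (e : endE R) (c d : R),
      algebraMap R (FractionRing R) d * e = algebraMap R (FractionRing R) c →
        ∀ x, d • ρ e x = c • x := by
  have hinj := IsFractionRing.injective R (FractionRing R)
  have hex (e : endE R) (x : M) : ∃ y : M, ∀ c d : R,
      algebraMap R (FractionRing R) d * e = algebraMap R (FractionRing R) c →
        d • y = c • x := by
    obtain ⟨c, d, hd, h⟩ := exists_algebraMap_mul_eq (A := R) (e : FractionRing R)
    obtain ⟨y, hy⟩ := hM c d hd (fun t ht => by
      obtain ⟨s, -, hs⟩ := mem_endE_iff.1 e.2 t ht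
      refine ⟨s, hinj ?_⟩
      rw [map_mul, map_mul, hs, ← h, mul_assoc]) x
    refine ⟨y, fun c' d' h' => smul_right_injective M hd ?_⟩
    have hcd : d * c' = d' * c := hinj (by rw [map_mul, map_mul, ← h, ← h', mul_left_comm])
    simp only
    rw [smul_comm, hy, smul_smul, smul_smul, hcd]
  choose T hT using hex
  have huniq (e : endE R) (x y : M) (h : ∀ c d : R,
      algebraMap R (FractionRing R) d * e = algebraMap R (FractionRing R) c →
        d • y = c • x) : T e x = y := by
    obtain ⟨c, d, hd, hcd⟩ := exists_algebraMap_mul_eq (A := R) (e : FractionRing R)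
    exact smul_right_injective M hd ((hT e x c d hcd).trans (h c d hcd).symm)
  let T' (e : endE R) : Module.End R M :=
    { toFun := T e
      map_add' := fun x y => huniq _ _ _ fun c d h => by
        rw [smul_add, hT e x c d h, hT e y c d h, smul_add]
      map_smul' := fun r x => huniq _ _ _ fun c d h => by
        rw [RingHom.id_apply, smul_comm, hT e x c d h, smul_comm] }
  have hone (r : R) : T' (algebraMap R (endE R) r) = algebraMap R (Module.End R M) r :=
    LinearMap.ext fun x => huniq _ _ _ fun c d h => by
      have h' : d * r = c := hinj (by rw [map_mul]; exact h)
      rw [Module.algebraMap_end_apply, smul_smul, h']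
  refine ⟨{ toFun := T', map_one' := ?_, map_mul' := fun e e' => ?_, map_zero' := ?_,
            map_add' := fun e e' => ?_, commutes' := hone }, fun e c d h x => hT e x c d h⟩
  · simpa using hone 1
  · refine LinearMap.ext fun x => ?_
    obtain ⟨c, d, hd, hcd⟩ := exists_algebraMap_mul_eq (A := R) (e : FractionRing R)
    obtain ⟨c', d', hd', hcd'⟩ := exists_algebraMap_mul_eq (A := R) (e' : FractionRing R)
    have h : algebraMap R (FractionRing R) (d * d') * (e * e' : endE R) =
        algebraMap R (FractionRing R) (c * c') := by
      rw [map_mul, map_mul, ← hcd, ← hcd']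
      push_cast
      ring
    refine smul_right_injective M (mul_ne_zero hd hd') ((hT _ x _ _ h).trans ?_)
    change _ = (d * d') • T e (T e' x)
    rw [mul_smul c, mul_comm d, mul_smul d', hT e _ c d hcd, smul_comm d' c, hT e' x c' d' hcd']
  · simpa using hone 0
  · refine LinearMap.ext fun x => huniq _ _ _ fun c d h => ?_
    obtain ⟨c₁, d₁, hd₁, h₁⟩ := exists_algebraMap_mul_eq (A := R) (e : FractionRing R)
    obtain ⟨c₂, d₂, hd₂, h₂⟩ := exists_algebraMap_mul_eq (A := R) (e' : FractionRing R)
    refine smul_right_injective M (mul_ne_zero hd₁ hd₂) ?_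
    have hc : d * (d₂ * c₁) + d * (d₁ * c₂) = (d₁ * d₂) * c := hinj (by
      simp only [map_add, map_mul]
      rw [← h₁, ← h₂, ← h]
      push_cast
      ring)
    change (d₁ * d₂) • d • (T e x + T e' x) = (d₁ * d₂) • c • x
    rw [← mul_smul (d₁ * d₂) c, ← hc, add_smul, smul_comm (d₁ * d₂) d, smul_add, smul_add,
      mul_smul d (d₂ * c₁), mul_smul d (d₁ * c₂), mul_smul d₂ c₁, mul_smul d₁ c₂,
      ← hT e x c₁ d₁ h₁, ← hT e' x c₂ d₂ h₂, mul_smul d₁ d₂, mul_smul d₁ d₂,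
      smul_comm d₁ d₂ (T e x)]

theorem exists_mul_eq_algebraMap_of_mem {A : Type*} [CommRing A] [IsLocalRing A] {a : A}
    (ha : a ∈ maximalIdeal A) (e : endE A) :
    ∃ s ∈ maximalIdeal A, algebraMap A (endE A) s = algebraMap A (endE A) a * e := by
  obtain ⟨s, hs, h⟩ := mem_endE_iff.1 e.2 a ha
  exact ⟨s, hs, Subtype.ext (h.trans (mul_comm _ _))⟩

theorem isUnit_one_sub_of_range_le {A M : Type*} [CommRing A] [IsLocalRing A] [AddCommGroup M]
    [Module A M] [Module.Finite A M]
    {ρ : endE A →ₐ[A] Module.End A M} (hρ : Function.Injective ρ) {e : endE A}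
    (he : LinearMap.range (ρ e) ≤ maximalIdeal A • ⊤) : IsUnit (1 - e) := by
  obtain ⟨p, hp, -, hcoeff, hpe⟩ :=
    LinearMap.exists_monic_and_natDegree_eq_and_coeff_mem_pow_and_aeval_eq_zero A (ρ e) _ he
  rw [Polynomial.aeval_algHom_apply, map_eq_zero_iff _ hρ, Polynomial.aeval_eq_sum_range,
    Finset.sum_range_succ, hp.coeff_natDegree, one_smul] at hpe
  have hsum : ∑ i ∈ Finset.range p.natDegree, p.coeff i • e ^ i ∈
      Submodule.map (Algebra.linearMap A (endE A)) (maximalIdeal A) := by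
    refine Submodule.sum_mem _ fun i hi => ?_
    have hi' : p.natDegree - i ≠ 0 := Nat.sub_ne_zero_of_lt (Finset.mem_range.1 hi)
    obtain ⟨s, hs, h⟩ := exists_mul_eq_algebraMap_of_mem
      (Ideal.pow_le_self hi' (hcoeff i)) (e ^ i)
    exact ⟨s, hs, h.trans (Algebra.smul_def _ _).symm⟩
  obtain ⟨s, hs, h⟩ := hsum
  have hpow : 1 - e ^ p.natDegree = algebraMap A (endE A) (1 + s) := by
    rw [map_add, map_one, ← Algebra.linearMap_apply, h, sub_eq_add_neg,
      eq_neg_of_add_eq_zero_left hpe]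
  have hu : IsUnit (1 + s) := by
    by_contra hn
    exact (maximalIdeal.isMaximal A).ne_top ((Ideal.eq_top_iff_one _).2
      ((Submodule.add_mem_iff_left _ hs).1 ((mem_maximalIdeal _).2 hn)))
  exact isUnit_of_dvd_unit (one_sub_dvd_one_sub_pow e _) (hpow ▸ hu.map (algebraMap A (endE A)))

theorem not_isUnit_of_range_le {A M : Type*} [CommRing A] [IsLocalRing A] [AddCommGroup M]
    [Module A M] [Module.Finite A M] [Nontrivial M] (ρ : endE A →ₐ[A] Module.End A M) {e : endE A}
    (he : LinearMap.range (ρ e) ≤ maximalIdeal A • ⊤) : ¬ IsUnit e := by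
  rintro ⟨u, rfl⟩
  refine maximalIdeal_smul_top_ne_top A M (eq_top_iff.2 fun x _ => ?_)
  have hx : ρ (↑u⁻¹ : endE A) (ρ u x) = x := by
    rw [← Module.End.mul_apply, ← map_mul, Units.inv_mul, map_one, Module.End.one_apply]
  have h := Submodule.mem_map_of_mem (f := ρ (↑u⁻¹ : endE A)) (he ⟨x, rfl⟩)
  rw [Submodule.map_smul'', hx] at h
  exact Submodule.smul_mono le_rfl le_top h

end Lemmas

/-- Main theorem: Let `(R, m, k)` be a one-dimensional Gorenstein local
domain and `E = End_R(m) = {α ∈ K : α·m ⊆ m}`.  If there exist finitely generated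
`R`-modules `M` and `N`, neither of them free, such that `M ⊗_R N` is torsion-free, then `E`
is a local ring and the inclusion `R → E` induces an isomorphism on residue fields (every
element of `E` is congruent to an element of `R` modulo the nonunits of `E`). -/
theorem stmt15 [IsNoetherianRing R] (hdim : ringKrullDim R = 1) (hGor : InjDimLEOne R)
    (hex : ∃ (M : Type u) (_ : AddCommGroup M) (_ : Module R M) (_ : Module.Finite R M)
      (N : Type u) (_ : AddCommGroup N) (_ : Module R N) (_ : Module.Finite R N),
      ¬ Module.Free R M ∧ ¬ Module.Free R N ∧
      ∀ (r : R) (x : TensorProduct R M N), r • x = 0 → r = 0 ∨ x = 0) :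
    IsLocalRing (endE R) ∧
    ∀ α : endE R, ∃ r : R, ¬ IsUnit (α - algebraMap R (endE R) r) := by
  have : Ring.KrullDimLE 1 R := Ring.krullDimLE_iff.2 hdim.le
  have hm : maximalIdeal R ≠ ⊥ := fun h => by
    have hfield := ringKrullDim_eq_zero_of_isField (isField_iff_maximalIdeal_eq.2 h)
    rw [hdim] at hfield
    exact one_ne_zero hfield
  obtain ⟨M₀, _, _, _, N₀, _, _, _, hM₀, hN₀, htf⟩ := hex
  have : Module.IsTorsionFree R (M₀ ⊗[R] N₀) := .of_smul_eq_zero htf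
  have : Nontrivial N₀ := not_subsingleton_iff_nontrivial.1 fun h => hN₀ inferInstance
  obtain ⟨M, _, _, _, _, _, _, hM⟩ := exists_reduction_of_isTorsionFree_tensor hM₀ N₀
  have : Module.IsTorsionFree R (N₀ ⊗[R] M) :=
    (TensorProduct.comm R N₀ M).injective.moduleIsTorsionFree _ (map_smul _)
  obtain ⟨N, _, _, _, _, _, _, hN⟩ := exists_reduction_of_isTorsionFree_tensor hN₀ M
  obtain ⟨ρ, hρ⟩ := exists_algHom_endE fun c d hd hcd =>
    hGor.exists_smul_eq_smul hm hM hd hcd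
  obtain ⟨σ, hσ⟩ := exists_algHom_endE fun c d hd hcd =>
    hGor.exists_smul_eq_smul hm hN hd hcd
  have htmul (e : endE R) (x : M) (y : N) : σ e y ⊗ₜ[R] x = y ⊗ₜ[R] ρ e x := by
    obtain ⟨c, d, hd, h⟩ := exists_algebraMap_mul_eq (A := R) (e : FractionRing R)
    refine smul_right_injective (N ⊗[R] M) hd ?_
    simp only
    rw [smul_tmul', hσ e c d h, ← tmul_smul, hρ e c d h, smul_tmul]
  have hρinj : Function.Injective ρ := by
    rw [injective_iff_map_eq_zero]
    intro e he
    obtain ⟨c, d, hd, h⟩ := exists_algebraMap_mul_eq (A := R) (e : FractionRing R)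
    obtain ⟨x, hx⟩ := exists_ne (0 : M)
    have hc : c • x = 0 := by rw [← hρ e c d h, he, LinearMap.zero_apply, smul_zero]
    rw [(smul_eq_zero.1 hc).resolve_right hx, map_zero] at h
    exact Subtype.ext ((mul_eq_zero.1 h).resolve_left (by simpa using hd))
  have hsub (e : endE R) : ∃ r : R,
      LinearMap.range (ρ (e - algebraMap R (endE R) r)) ≤ maximalIdeal R • ⊤ := by
    obtain ⟨ψ, y, hψ⟩ := exists_residueField_apply_eq_one R N
    obtain ⟨r, hr⟩ := residue_surjective (ψ (σ e y))
    refine ⟨r, ?_⟩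
    rintro _ ⟨x, rfl⟩
    by_contra hx
    obtain ⟨φ, hφ⟩ := exists_residueField_apply_eq_one_of_notMem hx
    have h := mul_eq_of_tmul_eq ψ φ (htmul e x y)
    rw [hψ, one_mul] at h
    rw [map_sub, AlgHom.commutes, LinearMap.sub_apply, Module.algebraMap_end_apply, map_sub,
      map_smul, ← h, ← hr, Algebra.smul_def, ResidueField.algebraMap_eq, sub_self] at hφ
    exact zero_ne_one hφ
  refine ⟨.of_isUnit_or_isUnit_one_sub_self fun e => ?_, fun e => ?_⟩
  · obtain ⟨r, hr⟩ := hsub e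
    by_cases hu : IsUnit r
    · left
      have h : LinearMap.range (ρ (1 - algebraMap R (endE R) ↑hu.unit⁻¹ * e)) ≤
          maximalIdeal R • ⊤ := by
        have h0 : algebraMap R (endE R) ↑hu.unit⁻¹ * algebraMap R (endE R) r = 1 := by
          rw [← map_mul, IsUnit.val_inv_mul, map_one]
        have h1 : 1 - algebraMap R (endE R) ↑hu.unit⁻¹ * e =
            (-↑hu.unit⁻¹ : R) • (e - algebraMap R (endE R) r) := by
          rw [Algebra.smul_def, map_neg]
          linear_combination -h0
        rw [h1, map_smul]
        rintro _ ⟨x, rfl⟩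
        exact Submodule.smul_mem _ _ (hr ⟨x, rfl⟩)
      have h2 := isUnit_one_sub_of_range_le hρinj h
      rw [sub_sub_cancel] at h2
      exact isUnit_of_mul_isUnit_right h2
    · right
      refine isUnit_one_sub_of_range_le hρinj ?_
      rintro _ ⟨x, rfl⟩
      have h := add_mem (hr ⟨x, rfl⟩)
        (Submodule.smul_mem_smul ((mem_maximalIdeal r).2 hu) (Submodule.mem_top (x := x)))
      simpa using h
  · obtain ⟨r, hr⟩ := hsub e
    exact ⟨r, not_isUnit_of_range_le ρ hr⟩
end

section
/- Over the pullback ring R of the maps i: k[T]/(T²) → k[X]/(X²) × k[X]/(X-1)² (sending a+bt to (a+bx, a+b(x-1))) and the natural surjection D → D/(X²(X-1)²) ≅ k[X]/(X²) × k[X]/(X-1)², where D = k[X] localized away from (X) and (X-1): R is a one-dimensional Gorenstein local domain, End_R(m) is local with residue field k, but the integral closure R̄ = D is not local. -/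
set_option synthInstance.maxHeartbeats 1000000
set_option maxHeartbeats 1000000

open Polynomial

universe u

variable (k : Type u) [Field k]

/-- `A = k[T]/(T²)`. -/
abbrev A19 : Type u := Polynomial k ⧸ Ideal.span {(X : Polynomial k) ^ 2}

/-- `B = k[X]/(X²) × k[X]/(X-1)²`. -/
abbrev B19 : Type u :=
  (Polynomial k ⧸ Ideal.span {(X : Polynomial k) ^ 2}) ×
    (Polynomial k ⧸ Ideal.span {((X : Polynomial k) - 1) ^ 2})

/-- The multiplicative set `k[X] \ ((X) ∪ (X-1))`, the complement of the union of the two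
prime ideals `(X)` and `(X-1)` of `k[X]`. -/
def S19 : Submonoid (Polynomial k) where
  carrier := {p : Polynomial k |
    p ∉ Ideal.span {(X : Polynomial k)} ∧ p ∉ Ideal.span {(X : Polynomial k) - 1}}
  one_mem' := by
    constructor
    · intro h
      rw [Ideal.mem_span_singleton] at h
      exact Polynomial.not_isUnit_X (isUnit_of_dvd_one h)
    · intro h
      rw [Ideal.mem_span_singleton] at h
      have h1 : IsUnit ((X : Polynomial k) - C 1) := by
        simpa using isUnit_of_dvd_one h
      have := Polynomial.natDegree_X_sub_C (1 : k)
      exact absurd (Polynomial.natDegree_eq_zero_of_isUnit h1) (by omega)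
  mul_mem' := by
    rintro a b ⟨ha1, ha2⟩ ⟨hb1, hb2⟩
    have hp1 : (Ideal.span {(X : Polynomial k)}).IsPrime :=
      (Ideal.span_singleton_prime Polynomial.X_ne_zero).mpr Polynomial.prime_X
    have hp2 : (Ideal.span {(X : Polynomial k) - 1}).IsPrime := by
      refine (Ideal.span_singleton_prime ?_).mpr ?_
      · simpa using Polynomial.X_sub_C_ne_zero (1 : k)
      · simpa using Polynomial.prime_X_sub_C (1 : k)
    constructor
    · intro h
      rcases hp1.mem_or_mem h with h' | h'
      exacts [ha1 h', hb1 h']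
    · intro h
      rcases hp2.mem_or_mem h with h' | h'
      exacts [ha2 h', hb2 h']

/-- `D = k[X]` localized at the complement of `(X) ∪ (X-1)`, a PID with two maximal
ideals. -/
abbrev D19 : Type u := Localization (S19 k)

theorem Module.Baer.of_maximalIdeal {R M : Type*} [CommRing R] [IsDomain R] [IsNoetherianRing R]
    [IsLocalRing R] [AddCommGroup M] [Module R M]
    (hdim : ∀ p : Ideal R, p.IsPrime → p ≠ ⊥ → p = IsLocalRing.maximalIdeal R)
    (hM : ∀ g : IsLocalRing.maximalIdeal R →ₗ[R] M, ∃ u : M, ∀ r, g r = (r : R) • u) :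
    Module.Baer R M := by
  intro I g
  rcases eq_or_ne I ⊥ with rfl | hI
  · refine ⟨0, fun x hx ↦ ?_⟩
    obtain rfl : x = 0 := by simpa using hx
    exact (map_zero g).symm
  obtain ⟨J, ⟨f, rfl, hgf⟩, hmax⟩ := set_has_maximal_iff_noetherian.mpr ‹IsNoetherianRing R›
    {J | ∃ f : R →ₗ.[R] M, f.domain = J ∧ (⟨I, g⟩ : R →ₗ.[R] M) ≤ f} ⟨I, ⟨I, g⟩, rfl, le_rfl⟩
  suffices htop : f.domain = ⊤ by
    refine ⟨f.toFun ∘ₗ LinearMap.codRestrict _ LinearMap.id (by simp [htop]), fun x hx ↦ ?_⟩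
    exact (hgf.2 (x := ⟨x, hx⟩) rfl).symm
  by_contra htop
  have hbot : f.domain ≠ ⊥ := fun h ↦ hI (le_bot_iff.mp (h ▸ hgf.1))
  have : Nontrivial (R ⧸ f.domain) := Ideal.Quotient.nontrivial_iff.mpr htop
  obtain ⟨p, hp⟩ := associatedPrimes.nonempty R (R ⧸ f.domain)
  obtain ⟨hprime, z, hz⟩ := isAssociatedPrime_iff.mp hp
  obtain ⟨x, rfl⟩ := Ideal.Quotient.mk_surjective z
  have hmem : ∀ r : R, r ∈ p ↔ r * x ∈ f.domain := fun r ↦ by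
    rw [hz, Submodule.mem_colon_singleton, Submodule.mem_bot, ← Ideal.Quotient.mk_eq_mk,
      ← Submodule.Quotient.mk_smul, Submodule.Quotient.mk_eq_zero, smul_eq_mul]
  have hpm : p = IsLocalRing.maximalIdeal R := by
    refine hdim p hprime fun h ↦ hbot (le_bot_iff.mp fun r hr ↦ ?_)
    exact h ▸ (hmem r).mpr (Ideal.mul_mem_right _ _ hr)
  have hx : x ∉ f.domain := fun h ↦
    hprime.ne_top ((Ideal.eq_top_iff_one _).mpr ((hmem 1).mpr (by simpa using h)))
  have hx0 : x ≠ 0 := fun h ↦ hx (h ▸ zero_mem _)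
  obtain ⟨u, hu⟩ := hM
    { toFun := fun r ↦ f ⟨r * x, (hmem _).mp (hpm ▸ r.2)⟩
      map_add' := fun r s ↦ by
        rw [← f.map_add]; congr 1; ext; simp [add_mul]
      map_smul' := fun r s ↦ by
        rw [RingHom.id_apply, ← f.map_smul]; congr 1; ext; simp [mul_assoc] }
  let f' := LinearPMap.mkSpanSingleton' (σ := RingHom.id R) x u fun c hc ↦ by
    obtain rfl : c = 0 := by simpa [hx0] using hc
    simp
  have hcompat : ∀ (a : f.domain) (b : f'.domain), (a : R) = b → f a = f' b := by
    rintro ⟨a, ha⟩ ⟨b, hb⟩ (rfl : a = b)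
    obtain ⟨c, rfl⟩ := Submodule.mem_span_singleton.mp hb
    have hc : c ∈ IsLocalRing.maximalIdeal R := hpm ▸ (hmem c).mpr ha
    exact (hu ⟨c, hc⟩).trans (LinearPMap.mkSpanSingleton'_apply x u _ c hb).symm
  refine hmax _ ⟨f.sup f' hcompat, rfl, hgf.trans (f.left_le_sup f' hcompat)⟩ ?_
  refine lt_of_le_of_ne le_sup_left fun h ↦ hx ?_
  rw [h]
  exact Submodule.mem_sup_right (Submodule.mem_span_singleton_self x)

theorem Module.Baer.of_isFractionRing {R K : Type*} [CommRing R] [IsDomain R] [Field K]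
    [Algebra R K] [IsFractionRing R K] : Module.Baer R K := by
  intro I g
  rcases eq_or_ne I ⊥ with rfl | hI
  · refine ⟨0, fun x hx ↦ ?_⟩
    obtain rfl : x = 0 := by simpa using hx
    exact (map_zero g).symm
  obtain ⟨c, hc, hc0⟩ := Submodule.exists_mem_ne_zero_of_ne_bot hI
  refine ⟨LinearMap.toSpanSingleton R K (g ⟨c, hc⟩ / algebraMap R K c), fun x hx ↦ ?_⟩
  have h : c • g ⟨x, hx⟩ = x • g ⟨c, hc⟩ := by
    rw [← map_smul, ← map_smul]; congr 1; ext; simp [mul_comm]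
  have : algebraMap R K c ≠ 0 := by simpa using hc0
  rw [Algebra.smul_def, Algebra.smul_def] at h
  rw [LinearMap.toSpanSingleton_apply, Algebra.smul_def]
  field_simp
  linear_combination -h

/-- If the maximal ideal `m` of `R` is generated by `t` and `t * s`, where `s` spans the
quotient `(R : m) / R`, then every `R`-linear map from `m` to `K / R` extends to `R`. -/
theorem exists_smul_eq_of_colon_maximalIdeal {R K : Type*} [CommRing R] [IsLocalRing R] [Field K]
    [Algebra R K] [FaithfulSMul R K] (t : K) (s : K) (ht0 : t ≠ 0) (t₁ t₂ : IsLocalRing.maximalIdeal R)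
    (ht₁ : algebraMap R K t₁ = t) (ht₂ : algebraMap R K t₂ = t * s)
    (hspan : ∀ r ∈ IsLocalRing.maximalIdeal R, ∃ a b : R, r = a * t₁ + b * t₂)
    (hs : ∀ r ∈ IsLocalRing.maximalIdeal R, ∃ r' : R, algebraMap R K r * s = algebraMap R K r')
    (hcolon : ∀ α : K, (∀ r ∈ IsLocalRing.maximalIdeal R, ∃ r' : R,
      α * algebraMap R K r = algebraMap R K r') →
      ∃ a b : R, α = algebraMap R K a + algebraMap R K b * s)
    (g : IsLocalRing.maximalIdeal R →ₗ[R] K ⧸ LinearMap.range (Algebra.linearMap R K)) :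
    ∃ u : K ⧸ LinearMap.range (Algebra.linearMap R K), ∀ r, g r = (r : R) • u := by
  obtain ⟨γ, hγ⟩ := Submodule.Quotient.mk_surjective _ (g t₁)
  obtain ⟨δ, hδ⟩ := Submodule.Quotient.mk_surjective _ (g t₂)
  have hmem : ∀ α : K, α ∈ LinearMap.range (Algebra.linearMap R K) ↔
      ∃ r : R, α = algebraMap R K r := fun α ↦ by simp [eq_comm]
  obtain ⟨a, b, hab⟩ := hcolon (δ - γ * s) fun r hr ↦ by
    obtain ⟨r', hr'⟩ := hs r hr
    have h : r • g t₂ = r' • g t₁ := by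
      rw [← map_smul, ← map_smul]
      congr 1
      ext
      apply FaithfulSMul.algebraMap_injective R K
      simp only [Submodule.coe_smul, smul_eq_mul, map_mul, ht₁, ht₂, ← hr']
      ring
    rw [← hγ, ← hδ, ← Submodule.Quotient.mk_smul, ← Submodule.Quotient.mk_smul,
      Submodule.Quotient.eq, hmem, Algebra.smul_def, Algebra.smul_def, ← hr'] at h
    obtain ⟨w, hw⟩ := h
    exact ⟨w, by linear_combination hw⟩
  refine ⟨Submodule.Quotient.mk ((γ + algebraMap R K b) / t), fun r ↦ ?_⟩
  have h₁ : g t₁ = (t₁ : R) • Submodule.Quotient.mk ((γ + algebraMap R K b) / t) := by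
    rw [← hγ, ← Submodule.Quotient.mk_smul, Submodule.Quotient.eq, hmem, Algebra.smul_def, ht₁]
    refine ⟨-b, ?_⟩
    rw [map_neg]
    field_simp
    ring
  have h₂ : g t₂ = (t₂ : R) • Submodule.Quotient.mk ((γ + algebraMap R K b) / t) := by
    rw [← hδ, ← Submodule.Quotient.mk_smul, Submodule.Quotient.eq, hmem, Algebra.smul_def, ht₂]
    refine ⟨a, ?_⟩
    field_simp
    linear_combination hab
  obtain ⟨c, d, h⟩ := hspan r r.2
  obtain rfl : r = c • t₁ + d • t₂ := by ext; simpa using h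
  rw [map_add, map_smul, map_smul, h₁, h₂, smul_smul, smul_smul, ← add_smul]
  simp

/-- An injective ring homomorphism `φ : R → D` into a `k`-algebra `D` with exactly two maximal
ideals `(x)` and `(x - 1)`, both with residue field `k`, whose image
`k + k x (x - 1) (2 x - 1) + x² (x - 1)² D` is a tacnode obtained by gluing the two points. -/
structure IsTacnode {R D : Type*} [CommRing R] [CommRing D] [Algebra k D]
    (x : D) (φ : R →+* D) : Prop where
  decomp (d : D) : ∃ (a b : k) (e : D),
    d = algebraMap k D a + algebraMap k D b * x + x * (x - 1) * e
  not_isUnit_left : ¬ IsUnit x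
  not_isUnit_right : ¬ IsUnit (x - 1)
  isUnit_one_add (d : D) : IsUnit (1 + x * (x - 1) * d)
  dvd_pow (d : D) : d ≠ 0 → ∃ N, d ∣ (x * (x - 1)) ^ N
  injective : Function.Injective φ
  mem_range (d : D) : (∃ r, φ r = d) ↔ ∃ (a b : k) (e : D),
    d = algebraMap k D a + algebraMap k D b * (x * (x - 1) * (2 * x - 1))
      + x ^ 2 * (x - 1) ^ 2 * e

namespace IsTacnode

variable {k} {R D : Type*} [CommRing R] [CommRing D] [Algebra k D]
  {x : D} {φ : R →+* D}

theorem eq_zero_of_eq_mul {z d : D} {a : k} (hz : ¬ IsUnit z) (h : algebraMap k D a = z * d) :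
    a = 0 := by
  by_contra ha
  exact hz (isUnit_of_mul_isUnit_left (h ▸ (IsUnit.mk0 a ha).map (algebraMap k D)))

variable (h : IsTacnode k x φ)
include h

theorem exists_map_eq (a b : k) (e : D) : ∃ r, φ r =
    algebraMap k D a + algebraMap k D b * (x * (x - 1) * (2 * x - 1))
      + x ^ 2 * (x - 1) ^ 2 * e :=
  (h.mem_range _).mpr ⟨a, b, e, rfl⟩

theorem exists_map_eq_sq_mul (e : D) : ∃ r, φ r = x ^ 2 * (x - 1) ^ 2 * e := by
  simpa using h.exists_map_eq 0 0 e

theorem left_ne_zero [Nontrivial D] : x ≠ 0 := by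
  rintro rfl
  exact h.not_isUnit_right (by simp)

theorem right_ne_zero [Nontrivial D] : x - 1 ≠ 0 := fun hx ↦
  h.not_isUnit_left (by simp [sub_eq_zero.mp hx])

theorem isUnit_two_mul_sub_one : IsUnit (2 * x - 1) := by
  refine isUnit_of_mul_isUnit_left (y := 2 * x - 1) ?_
  convert h.isUnit_one_add 4 using 1
  ring

theorem not_isUnit_mul (d : D) : ¬ IsUnit (x * (x - 1) * d) := fun hu ↦
  h.not_isUnit_left (isUnit_of_mul_isUnit_left (isUnit_of_mul_isUnit_left hu))

theorem exists_mul_eq_one {a : k} (ha : a ≠ 0) (d : D) : ∃ e,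
    (algebraMap k D a + x * (x - 1) * d) * (algebraMap k D a⁻¹ + x * (x - 1) * e) = 1 := by
  have hc : algebraMap k D a * algebraMap k D a⁻¹ = 1 := by
    rw [← map_mul, mul_inv_cancel₀ ha, map_one]
  obtain ⟨v, hv⟩ := (h.isUnit_one_add (d * algebraMap k D a⁻¹)).exists_right_inv
  refine ⟨-(d * algebraMap k D a⁻¹ * algebraMap k D a⁻¹ * v), ?_⟩
  linear_combination (x * (x - 1) * d * algebraMap k D a⁻¹ * v * (-1) + 1) * hc
    + x * (x - 1) * d * algebraMap k D a⁻¹ * (- hv)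

theorem isUnit_of_map_eq {r : R} {a b : k} {e : D} (ha : a ≠ 0) (hr : φ r =
    algebraMap k D a + algebraMap k D b * (x * (x - 1) * (2 * x - 1))
      + x ^ 2 * (x - 1) ^ 2 * e) : IsUnit r := by
  have hc : algebraMap k D a * algebraMap k D a⁻¹ = 1 := by
    rw [← map_mul, mul_inv_cancel₀ ha, map_one]
  set A := algebraMap k D a⁻¹ with hA
  set B := algebraMap k D b
  set t := x * (x - 1) * (2 * x - 1) with ht
  set q := e * A * (1 - B * A * t) - (B * A) ^ 2 * (2 * x - 1) ^ 2
  obtain ⟨v, hv⟩ := (h.isUnit_one_add (x * (x - 1) * q)).exists_right_inv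
  obtain ⟨s, hs⟩ := h.exists_map_eq a⁻¹ (-(b * a⁻¹ * a⁻¹)) (-(A * (1 - B * A * t) * q * v))
  refine IsUnit.of_mul_eq_one s (h.injective ?_)
  have hv' : 1 - x ^ 2 * (x - 1) ^ 2 * (q * v) = v := by linear_combination -hv
  have hs' : φ s = A * (1 - B * A * t) * v := by
    rw [hs, map_neg, map_mul, map_mul, ← ht, ← hA]
    linear_combination A * (1 - B * A * t) * hv'
  have hr' : A * φ r * (1 - B * A * t) = 1 + x * (x - 1) * (x * (x - 1) * q) := by
    rw [hr]
    linear_combination (1 - B * A * t) * hc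
  rw [map_mul, map_one, hs']
  linear_combination v * hr' + hv

theorem exists_map_eq_of_mem_nonunits {r : R} (hr : r ∈ nonunits R) : ∃ (b : k) (e : D),
    φ r = algebraMap k D b * (x * (x - 1) * (2 * x - 1)) + x ^ 2 * (x - 1) ^ 2 * e := by
  obtain ⟨a, b, e, hd⟩ := (h.mem_range _).mp ⟨r, rfl⟩
  obtain rfl : a = 0 := by
    by_contra ha
    exact hr (h.isUnit_of_map_eq ha hd)
  exact ⟨b, e, by simpa using hd⟩

theorem mem_nonunits_of_map_eq {r : R} {d : D} (hr : φ r = x * (x - 1) * d) : r ∈ nonunits R :=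
  fun hu ↦ h.not_isUnit_mul d (hr ▸ hu.map φ)

theorem mem_nonunits_iff {r : R} : r ∈ nonunits R ↔ ∃ d, φ r = x * (x - 1) * d := by
  refine ⟨fun hr ↦ ?_, fun ⟨d, hd⟩ ↦ h.mem_nonunits_of_map_eq hd⟩
  obtain ⟨b, e, hr⟩ := h.exists_map_eq_of_mem_nonunits hr
  exact ⟨algebraMap k D b * (2 * x - 1) + x * (x - 1) * e, by rw [hr]; ring⟩

theorem exists_map_eq_mul_of_mem_nonunits {r : R} (hr : r ∈ nonunits R) : ∃ (b : k) (e : D),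
    φ r = x * (x - 1) * (2 * x - 1) * (algebraMap k D b + x * (x - 1) * e) := by
  obtain ⟨b, e, hr⟩ := h.exists_map_eq_of_mem_nonunits hr
  obtain ⟨w, hw⟩ := h.isUnit_two_mul_sub_one.exists_right_inv
  exact ⟨b, w * e, by rw [hr]; linear_combination -x ^ 2 * (x - 1) ^ 2 * e * hw⟩

theorem exists_eq_add_mul (a : k) (d : D) : ∃ p q : R,
    algebraMap k D a + x * (x - 1) * d = φ p + φ q * (x ^ 2 * (x - 1)) := by
  obtain ⟨d₀, d₁, e, rfl⟩ := h.decomp d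
  obtain ⟨p, hp⟩ := h.exists_map_eq a (-d₀) e
  obtain ⟨q, hq⟩ := h.exists_map_eq (2 * d₀ + d₁) 0 0
  refine ⟨p, q, ?_⟩
  rw [hp, hq]
  simp only [map_neg, map_add, map_mul, map_ofNat, map_zero]
  ring

theorem isLocalRing [Nontrivial D] : IsLocalRing R := by
  have : Nontrivial R := φ.domain_nontrivial
  refine IsLocalRing.of_nonunits_add fun r s hr hs ↦ ?_
  rw [h.mem_nonunits_iff] at *
  obtain ⟨d, hd⟩ := hr
  obtain ⟨e, he⟩ := hs
  exact ⟨d + e, by rw [map_add, hd, he, mul_add]⟩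

theorem exists_generators [IsLocalRing R] : ∃ t₁ t₂ : IsLocalRing.maximalIdeal R,
    φ t₁ = x * (x - 1) * (2 * x - 1) ∧
    φ t₂ = x * (x - 1) * (2 * x - 1) * (x ^ 2 * (x - 1)) ∧
    ∀ r ∈ IsLocalRing.maximalIdeal R, ∃ a b : R, r = a * t₁ + b * t₂ := by
  obtain ⟨t₁, h₁⟩ := h.exists_map_eq 0 1 0
  obtain ⟨t₂, h₂⟩ := h.exists_map_eq_sq_mul (x * (2 * x - 1))
  replace h₁ : φ t₁ = x * (x - 1) * (2 * x - 1) := by simpa using h₁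
  replace h₂ : φ t₂ = x * (x - 1) * (2 * x - 1) * (x ^ 2 * (x - 1)) := by rw [h₂]; ring
  refine ⟨⟨t₁, h.mem_nonunits_of_map_eq h₁⟩,
    ⟨t₂, h.mem_nonunits_of_map_eq (h₂.trans (mul_assoc _ _ _))⟩, h₁, h₂, fun r hr ↦ ?_⟩
  obtain ⟨b, e, hr⟩ := h.exists_map_eq_mul_of_mem_nonunits hr
  obtain ⟨p, q, hpq⟩ := h.exists_eq_add_mul b e
  refine ⟨p, q, h.injective ?_⟩
  rw [hr, hpq, map_add, map_mul, map_mul, h₁, h₂]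
  ring

theorem maximalIdeal_le_radical [IsLocalRing R] {c : R} (hc : c ≠ 0) :
    IsLocalRing.maximalIdeal R ≤ (Ideal.span {c}).radical := by
  obtain ⟨N, g, hg⟩ := h.dvd_pow (φ c) ((map_ne_zero_iff φ h.injective).mpr hc)
  intro z hz
  obtain ⟨d, hd⟩ := h.mem_nonunits_iff.mp hz
  obtain ⟨r, hr⟩ := h.exists_map_eq_sq_mul (g * d ^ (N + 2))
  refine ⟨N + 2, Ideal.mem_span_singleton.mpr ⟨r, h.injective ?_⟩⟩
  rw [map_pow, map_mul, hd, hr, mul_pow, pow_add, hg]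
  ring

theorem eq_maximalIdeal [IsLocalRing R] {p : Ideal R} (hp : p.IsPrime) (hbot : p ≠ ⊥) :
    p = IsLocalRing.maximalIdeal R := by
  obtain ⟨c, hc, hc0⟩ := Submodule.exists_mem_ne_zero_of_ne_bot hbot
  refine le_antisymm (IsLocalRing.le_maximalIdeal hp.ne_top)
    ((h.maximalIdeal_le_radical hc0).trans ?_)
  exact hp.radical_le_iff.mpr ((Ideal.span_singleton_le_iff_mem _).mpr hc)

theorem isNoetherianRing [IsLocalRing R] : IsNoetherianRing R := by
  refine IsNoetherianRing.of_prime_ne_bot fun p hp hbot ↦ ?_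
  obtain ⟨t₁, t₂, -, -, ht⟩ := h.exists_generators
  rw [h.eq_maximalIdeal hp hbot]
  classical
  refine ⟨({t₁.1, t₂.1} : Finset R), ?_⟩
  rw [Finset.coe_pair]
  refine le_antisymm ?_ fun r hr ↦ ?_
  · rw [Ideal.span_le]
    rintro _ (rfl | rfl)
    exacts [t₁.2, t₂.2]
  · obtain ⟨a, b, rfl⟩ := ht r hr
    exact Ideal.mem_span_pair.mpr ⟨a, b, rfl⟩

theorem isDomain [IsDomain D] : IsDomain R := h.injective.isDomain φ

theorem ringKrullDim_eq_one [IsDomain D] [IsDomain R] [IsLocalRing R] : ringKrullDim R = 1 := by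
  refine ringKrullDim_eq_one_iff_of_isLocalRing_isDomain.mpr
    ⟨fun hF ↦ ?_, fun c ↦ h.maximalIdeal_le_radical⟩
  obtain ⟨r, hr⟩ := h.exists_map_eq_sq_mul 1
  have hr0 : r ≠ 0 := by
    rintro rfl
    simp [h.left_ne_zero, h.right_ne_zero] at hr
  obtain ⟨s, hs⟩ := hF.mul_inv_cancel hr0
  exact h.mem_nonunits_of_map_eq (d := x * (x - 1)) (by rw [hr]; ring) (IsUnit.of_mul_eq_one s hs)

theorem exists_mul_map_eq_map [IsDomain D] (d : D) : ∃ r s : R, s ≠ 0 ∧ d * φ s = φ r := by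
  obtain ⟨s, hs⟩ := h.exists_map_eq_sq_mul 1
  obtain ⟨r, hr⟩ := h.exists_map_eq_sq_mul d
  refine ⟨r, s, ?_, by rw [hs, hr]; ring⟩
  rintro rfl
  simp [h.left_ne_zero, h.right_ne_zero] at hs

theorem isIntegral : φ.IsIntegral := by
  have hc (a : k) : φ.IsIntegralElem (algebraMap k D a) := by
    obtain ⟨r, hr⟩ := h.exists_map_eq a 0 0
    replace hr : φ r = algebraMap k D a := by simpa using hr
    exact hr ▸ φ.isIntegralElem_map
  have hxy (d : D) : φ.IsIntegralElem (x * (x - 1) * d) := by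
    obtain ⟨r, hr⟩ := h.exists_map_eq_sq_mul (d ^ 2)
    refine ⟨Polynomial.X ^ 2 - Polynomial.C r, Polynomial.monic_X_pow_sub_C r two_ne_zero, ?_⟩
    simp only [Polynomial.eval₂_sub, Polynomial.eval₂_pow, Polynomial.eval₂_X,
      Polynomial.eval₂_C, hr]
    ring
  have hx : φ.IsIntegralElem x := by
    obtain ⟨r, hr⟩ := h.exists_map_eq_sq_mul 1
    refine ⟨(Polynomial.X ^ 2 - Polynomial.X) ^ 2 - Polynomial.C r, ?_, ?_⟩
    · nontriviality R
      monicity!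
    · simp only [Polynomial.eval₂_sub, Polynomial.eval₂_pow, Polynomial.eval₂_X,
        Polynomial.eval₂_C, hr]
      ring
  intro d
  obtain ⟨a, b, e, rfl⟩ := h.decomp d
  exact ((hc a).add φ ((hc b).mul φ hx)).add φ (hxy e)

variable {K : Type*} [Field K] [Algebra R K]

theorem exists_lift [IsDomain D] [FaithfulSMul R K] : ∃ j : D →+* K, Function.Injective j ∧
    ∀ r, j (φ r) = algebraMap R K r := by
  choose ρ hρ using h.exists_map_eq_sq_mul
  have hinj := FaithfulSMul.algebraMap_injective R K
  have hρ0 : algebraMap R K (ρ 1) ≠ 0 := by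
    rw [map_ne_zero_iff _ hinj]
    intro h0
    simpa [h0, h.left_ne_zero, h.right_ne_zero] using hρ 1
  have hzero : ρ 0 = 0 := h.injective (by simp [hρ])
  have hadd (d e : D) : ρ (d + e) = ρ d + ρ e := h.injective (by simp only [hρ, map_add]; ring)
  have hmul (d e : D) : ρ (d * e) * ρ 1 = ρ d * ρ e :=
    h.injective (by simp only [hρ, map_mul]; ring)
  have hmap (r : R) : ρ (φ r) = r * ρ 1 := h.injective (by simp only [hρ, map_mul]; ring)
  let j : D →+* K :=
    { toFun := fun d ↦ algebraMap R K (ρ d) / algebraMap R K (ρ 1)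
      map_one' := div_self hρ0
      map_zero' := by simp [hzero]
      map_add' := fun d e ↦ by rw [hadd, map_add, add_div]
      map_mul' := fun d e ↦ by
        have := congrArg (algebraMap R K) (hmul d e)
        simp only [map_mul] at this
        field_simp
        exact this }
  refine ⟨j, (injective_iff_map_eq_zero j).mpr fun d hd ↦ ?_, fun r ↦ ?_⟩
  · have hd' : ρ d = 0 := by
      rcases div_eq_zero_iff.mp (show algebraMap R K (ρ d) / algebraMap R K (ρ 1) = 0 from hd)
        with h' | h'
      exacts [(map_eq_zero_iff _ hinj).mp h', absurd h' hρ0]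
    simpa [hd', h.left_ne_zero, h.right_ne_zero] using (hρ d).symm
  · change algebraMap R K (ρ (φ r)) / algebraMap R K (ρ 1) = _
    rw [hmap, map_mul, mul_div_assoc, div_self hρ0, mul_one]

variable {j : D →+* K} (hj : Function.Injective j) (hjφ : ∀ r, j (φ r) = algebraMap R K r)
include hj hjφ

theorem exists_eq_of_mul_mem [IsDomain D] {α : K}
    (hα : ∀ z ∈ nonunits R, ∃ r, α * algebraMap R K z = algebraMap R K r) :
    ∃ (a : k) (d : D), α = j (algebraMap k D a + x * (x - 1) * d) := by
  obtain ⟨T, hT⟩ := h.exists_map_eq 0 1 0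
  replace hT : φ T = x * (x - 1) * (2 * x - 1) := by simpa using hT
  obtain ⟨F, hF⟩ := h.exists_map_eq_sq_mul (x * (2 * x - 1))
  obtain ⟨r, hr⟩ := hα T (h.mem_nonunits_of_map_eq hT)
  obtain ⟨s, hs⟩ := hα F (h.mem_nonunits_of_map_eq
    (d := x * (x - 1) * (x * (2 * x - 1))) (by rw [hF]; ring))
  rw [← hjφ, ← hjφ, hT] at hr
  rw [← hjφ, ← hjφ, hF] at hs
  have hrs : φ r * (x ^ 2 * (x - 1)) = φ s := hj (by
    rw [map_mul, ← hr, ← hs, mul_assoc, ← map_mul]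
    congr 2
    ring)
  obtain ⟨a, b, e, hae⟩ := (h.mem_range _).mp ⟨r, rfl⟩
  obtain ⟨a', b', e', hae'⟩ := (h.mem_range _).mp ⟨s, rfl⟩
  have ha' : a' = 0 := eq_zero_of_eq_mul (z := x * (x - 1))
    (d := φ r * x - algebraMap k D b' * (2 * x - 1) - x * (x - 1) * e')
    (by simpa using h.not_isUnit_mul 1) (by linear_combination -hrs - hae')
  rw [ha', map_zero, zero_add] at hae'
  have h₁ : φ r * x = algebraMap k D b' * (2 * x - 1) + x * (x - 1) * e' :=
    mul_left_cancel₀ (mul_ne_zero h.left_ne_zero h.right_ne_zero) (by linear_combination hrs + hae')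
  have hb' : b' = 0 := eq_zero_of_eq_mul (z := x)
    (d := algebraMap k D b' * 2 - φ r + (x - 1) * e')
    h.not_isUnit_left (by linear_combination h₁)
  rw [hb', map_zero, zero_mul, zero_add] at h₁
  have h₂ : φ r = (x - 1) * e' := mul_left_cancel₀ h.left_ne_zero (by linear_combination h₁)
  have ha : a = 0 := eq_zero_of_eq_mul (z := x - 1)
    (d := e' - algebraMap k D b * (x * (2 * x - 1)) - x ^ 2 * (x - 1) * e)
    h.not_isUnit_right (by linear_combination h₂ - hae)
  rw [ha, map_zero, zero_add] at hae
  obtain ⟨b, e, hbe⟩ := h.exists_map_eq_mul_of_mem_nonunits (h.mem_nonunits_of_map_eq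
    (d := algebraMap k D b * (2 * x - 1) + x * (x - 1) * e) (by rw [hae]; ring))
  refine ⟨b, e, ?_⟩
  have ht0 : j (x * (x - 1) * (2 * x - 1)) ≠ 0 := (map_ne_zero_iff j hj).mpr
    (mul_ne_zero (mul_ne_zero h.left_ne_zero h.right_ne_zero) h.isUnit_two_mul_sub_one.ne_zero)
  apply mul_right_cancel₀ ht0
  rw [hr, hbe, map_mul, mul_comm]

theorem mem_endomorphisms_iff [IsDomain D] {α : K} :
    (∀ z ∈ nonunits R, α * algebraMap R K z ∈ algebraMap R K '' nonunits R) ↔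
      ∃ (a : k) (d : D), α = j (algebraMap k D a + x * (x - 1) * d) := by
  constructor
  · intro hα
    refine h.exists_eq_of_mul_mem hj hjφ fun z hz ↦ ?_
    obtain ⟨r, -, hr⟩ := hα z hz
    exact ⟨r, hr.symm⟩
  · rintro ⟨a, d, rfl⟩ z hz
    obtain ⟨b, e, hbe⟩ := h.exists_map_eq_of_mem_nonunits hz
    obtain ⟨r, hr⟩ := h.exists_map_eq 0 (a * b) (algebraMap k D a * e
      + d * algebraMap k D b * (2 * x - 1) + x * (x - 1) * d * e)
    rw [map_zero, zero_add, map_mul] at hr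
    refine ⟨r, h.mem_nonunits_iff.mpr ⟨algebraMap k D a * algebraMap k D b * (2 * x - 1)
      + x * (x - 1) * (algebraMap k D a * e + d * algebraMap k D b * (2 * x - 1)
        + x * (x - 1) * d * e), by rw [hr]; ring⟩, ?_⟩
    rw [← hjφ, ← hjφ, ← map_mul, hr, hbe]
    congr 1
    ring

theorem exists_inverse_iff [IsDomain D] {a : k} {d : D} :
    (∃ γ ∈ {α : K | ∀ z ∈ nonunits R, α * algebraMap R K z ∈ algebraMap R K '' nonunits R},
      j (algebraMap k D a + x * (x - 1) * d) * γ = 1) ↔ a ≠ 0 := by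
  constructor
  · rintro ⟨γ, hγ, hmul⟩ rfl
    obtain ⟨b, e, rfl⟩ := (h.mem_endomorphisms_iff hj hjφ).mp hγ
    rw [← map_mul, ← map_one j] at hmul
    have := hj hmul
    rw [map_zero, zero_add] at this
    exact h.not_isUnit_mul d (IsUnit.of_mul_eq_one _ this)
  · intro ha
    obtain ⟨e, he⟩ := h.exists_mul_eq_one ha d
    exact ⟨_, (h.mem_endomorphisms_iff hj hjφ).mpr ⟨a⁻¹, e, rfl⟩, by rw [← map_mul, he, map_one]⟩

omit hj hjφ in
theorem baer_quotient [IsDomain D] [IsDomain R] [IsLocalRing R] [FaithfulSMul R K] :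
    Module.Baer R (K ⧸ LinearMap.range (Algebra.linearMap R K)) := by
  obtain ⟨j, hj, hjφ⟩ := h.exists_lift (K := K)
  have := h.isNoetherianRing
  refine Module.Baer.of_maximalIdeal (fun p hp hbot ↦ h.eq_maximalIdeal hp hbot) ?_
  obtain ⟨t₁, t₂, h₁, h₂, ht⟩ := h.exists_generators
  refine exists_smul_eq_of_colon_maximalIdeal (j (x * (x - 1) * (2 * x - 1))) (j (x ^ 2 * (x - 1)))
    ((map_ne_zero_iff j hj).mpr (mul_ne_zero (mul_ne_zero h.left_ne_zero h.right_ne_zero)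
      h.isUnit_two_mul_sub_one.ne_zero)) t₁ t₂ (by rw [← hjφ, h₁]) (by rw [← hjφ, h₂, map_mul])
    ht (fun r hr ↦ ?_) fun α hα ↦ ?_
  · obtain ⟨b, e, hbe⟩ := h.exists_map_eq_of_mem_nonunits hr
    obtain ⟨s, hs⟩ := h.exists_map_eq_sq_mul
      (algebraMap k D b * (x * (2 * x - 1)) + x ^ 2 * (x - 1) * e)
    refine ⟨s, ?_⟩
    rw [← hjφ, ← hjφ, ← map_mul, hbe, hs]
    congr 1
    ring
  · obtain ⟨a, d, rfl⟩ := h.exists_eq_of_mul_mem hj hjφ hα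
    obtain ⟨p, q, hpq⟩ := h.exists_eq_add_mul a d
    exact ⟨p, q, by rw [hpq, map_add, map_mul, hjφ, hjφ]⟩

end IsTacnode

section

variable {k}

theorem mem_S19_iff {p : k[X]} : p ∈ S19 k ↔ p.eval 0 ≠ 0 ∧ p.eval 1 ≠ 0 := by
  change p ∉ Ideal.span _ ∧ p ∉ Ideal.span _ ↔ _
  rw [← C_1, Ideal.mem_span_singleton, Ideal.mem_span_singleton, dvd_iff_isRoot, X_dvd_iff,
    coeff_zero_eq_eval_zero, IsRoot.def]

variable (k) in
theorem S19_le_nonZeroDivisors : S19 k ≤ nonZeroDivisors k[X] := fun p hp ↦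
  mem_nonZeroDivisors_of_ne_zero fun h ↦ (mem_S19_iff.mp hp).1 (by rw [h, eval_zero])

instance : IsDomain (D19 k) :=
  IsLocalization.isDomain_localization (S19_le_nonZeroDivisors k)

theorem exists_mul_eq_algebraMap (d : D19 k) : ∃ p, ∃ q ∈ S19 k,
    d * algebraMap k[X] (D19 k) q = algebraMap k[X] (D19 k) p := by
  obtain ⟨⟨p, q⟩, h⟩ := IsLocalization.surj (S19 k) d
  exact ⟨p, q, q.2, h⟩

theorem isUnit_algebraMap_iff {p : k[X]} : IsUnit (algebraMap k[X] (D19 k) p) ↔ p ∈ S19 k := by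
  refine ⟨fun hu ↦ mem_S19_iff.mpr ⟨?_, ?_⟩, fun hp ↦ IsLocalization.map_units _ ⟨p, hp⟩⟩
  · have hev (q : S19 k) : IsUnit (evalRingHom (0 : k) q) :=
      IsUnit.mk0 _ (mem_S19_iff.mp q.2).1
    simpa using hu.map (IsLocalization.lift (S := D19 k) hev)
  · have hev (q : S19 k) : IsUnit (evalRingHom (1 : k) q) :=
      IsUnit.mk0 _ (mem_S19_iff.mp q.2).2
    simpa using hu.map (IsLocalization.lift (S := D19 k) hev)

theorem exists_eq_add_X_mul_X_sub_one (p : k[X]) : ∃ (a b : k) (q : k[X]),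
    p = C a + C b * X + X * (X - 1) * q := by
  obtain ⟨p₁, h₁⟩ := X_sub_C_dvd_sub_C_eval (a := (0 : k)) (p := p)
  obtain ⟨p₂, h₂⟩ := X_sub_C_dvd_sub_C_eval (a := (1 : k)) (p := p₁)
  rw [C_0] at h₁
  rw [C_1] at h₂
  exact ⟨p.eval 0, p₁.eval 1, p₂, by linear_combination h₁ + X * h₂⟩

theorem isCoprime_of_mem_S19 {q : k[X]} (hq : q ∈ S19 k) : IsCoprime q (X * (X - 1)) := by
  refine IsCoprime.mul_right ?_ ?_
  · exact (prime_X.irreducible.coprime_iff_not_dvd.mpr fun h ↦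
      hq.1 (Ideal.mem_span_singleton.mpr h)).symm
  · refine (Irreducible.coprime_iff_not_dvd ?_ |>.mpr fun h ↦
      hq.2 (Ideal.mem_span_singleton.mpr h)).symm
    simpa using irreducible_X_sub_C (1 : k)

theorem algebraMap_D19_eq (a : k) :
    algebraMap k (D19 k) a = algebraMap k[X] (D19 k) (C a) :=
  IsScalarTower.algebraMap_apply k k[X] (D19 k) a

theorem decomp_D19 (d : D19 k) : ∃ (a b : k) (e : D19 k),
    d = algebraMap k (D19 k) a + algebraMap k (D19 k) b * algebraMap k[X] (D19 k) X
      + algebraMap k[X] (D19 k) X * (algebraMap k[X] (D19 k) X - 1) * e := by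
  obtain ⟨p, q, hq, hd⟩ := exists_mul_eq_algebraMap d
  obtain ⟨u, v, huv⟩ := isCoprime_of_mem_S19 hq
  obtain ⟨a, b, r, hr⟩ := exists_eq_add_X_mul_X_sub_one (p * u)
  refine ⟨a, b, algebraMap _ _ r + d * algebraMap _ _ v, ?_⟩
  apply_fun algebraMap k[X] (D19 k) at huv hr
  simp only [map_add, map_mul, map_sub, map_one, ← algebraMap_D19_eq] at huv hr
  linear_combination hr + algebraMap _ _ u * hd - d * huv

theorem isUnit_one_add_D19 (d : D19 k) : IsUnit
    (1 + algebraMap k[X] (D19 k) X * (algebraMap k[X] (D19 k) X - 1) * d) := by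
  obtain ⟨p, q, hq, hd⟩ := exists_mul_eq_algebraMap d
  refine isUnit_of_mul_isUnit_left (y := algebraMap k[X] (D19 k) q) ?_
  have : (1 + algebraMap k[X] (D19 k) X * (algebraMap k[X] (D19 k) X - 1) * d)
      * algebraMap k[X] (D19 k) q = algebraMap k[X] (D19 k) (q + X * (X - 1) * p) := by
    simp only [map_add, map_mul, map_sub, map_one]
    linear_combination algebraMap k[X] (D19 k) X * (algebraMap k[X] (D19 k) X - 1) * hd
  rw [this, isUnit_algebraMap_iff, mem_S19_iff]
  simpa using mem_S19_iff.mp hq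

theorem exists_dvd_pow_mul {p : k[X]} (hp : p ≠ 0) :
    ∃ N : ℕ, ∃ s ∈ S19 k, p ∣ (X * (X - 1)) ^ N * s := by
  obtain ⟨q, hq, hq'⟩ := p.exists_eq_pow_rootMultiplicity_mul_and_not_dvd hp 0
  have hq0 : q ≠ 0 := fun h ↦ hq' (h ▸ dvd_zero _)
  obtain ⟨s, hs, hs'⟩ := q.exists_eq_pow_rootMultiplicity_mul_and_not_dvd hq0 1
  rw [dvd_iff_isRoot, IsRoot.def] at hq' hs'
  set m := p.rootMultiplicity 0
  set n := q.rootMultiplicity 1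
  refine ⟨m + n, s, mem_S19_iff.mpr ⟨fun h ↦ hq' ?_, hs'⟩, X ^ n * (X - 1) ^ m, ?_⟩
  · rw [hs, eval_mul, h, mul_zero]
  · rw [hq, hs, C_0, C_1, mul_pow]
    ring

theorem dvd_pow_D19 {d : D19 k} (hd0 : d ≠ 0) : ∃ N, d ∣
    (algebraMap k[X] (D19 k) X * (algebraMap k[X] (D19 k) X - 1)) ^ N := by
  obtain ⟨p, q, hq, hd⟩ := exists_mul_eq_algebraMap d
  have hp : p ≠ 0 := by
    rintro rfl
    rw [map_zero] at hd
    exact (mul_ne_zero hd0 (isUnit_algebraMap_iff.mpr hq).ne_zero) hd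
  obtain ⟨N, s, hs, hdvd⟩ := exists_dvd_pow_mul hp
  refine ⟨N, (Dvd.intro _ hd).trans ?_⟩
  have := map_dvd (algebraMap k[X] (D19 k)) hdvd
  rw [map_mul, (isUnit_algebraMap_iff.mpr hs).dvd_mul_right] at this
  simpa using this

theorem not_isLocalRing_D19 : ¬ IsLocalRing (D19 k) := fun _ ↦ by
  have hX : ¬ IsUnit (algebraMap k[X] (D19 k) X) := by simp [isUnit_algebraMap_iff, mem_S19_iff]
  have hX' : ¬ IsUnit (algebraMap k[X] (D19 k) (1 - X)) := by
    rw [isUnit_algebraMap_iff]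
    simp [mem_S19_iff]
  refine IsLocalRing.nonunits_add hX hX' ?_
  rw [← map_add]
  simp

theorem map_eq_zero_iff_dvd {π : D19 k →+* B19 k}
    (hπ : ∀ p, π (algebraMap k[X] (D19 k) p) = (Ideal.Quotient.mk _ p, Ideal.Quotient.mk _ p))
    {d : D19 k} : π d = 0 ↔ ∃ e,
      d = algebraMap k[X] (D19 k) X ^ 2 * (algebraMap k[X] (D19 k) X - 1) ^ 2 * e := by
  constructor
  · intro hd
    obtain ⟨p, q, hq, hpq⟩ := exists_mul_eq_algebraMap d
    have hp : π (algebraMap _ _ p) = 0 := by rw [← hpq, map_mul, hd, zero_mul]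
    rw [hπ, Prod.mk_eq_zero, Ideal.Quotient.eq_zero_iff_mem, Ideal.Quotient.eq_zero_iff_mem,
      Ideal.mem_span_singleton, Ideal.mem_span_singleton] at hp
    have hcop : IsCoprime (X : k[X]) (X - 1) := ⟨1, -1, by ring⟩
    obtain ⟨r, rfl⟩ := (hcop.pow (m := 2) (n := 2)).mul_dvd hp.1 hp.2
    obtain ⟨v, hv⟩ := (isUnit_algebraMap_iff.mpr hq).exists_right_inv
    refine ⟨algebraMap _ _ r * v, ?_⟩
    simp only [map_mul, map_pow, map_sub, map_one] at hpq
    linear_combination v * hpq - d * hv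
  · rintro ⟨e, rfl⟩
    have : algebraMap k[X] (D19 k) X ^ 2 * (algebraMap k[X] (D19 k) X - 1) ^ 2 =
        algebraMap k[X] (D19 k) (X ^ 2 * (X - 1) ^ 2) := by simp
    rw [map_mul, this, hπ]
    refine mul_eq_zero_of_left ?_ _
    rw [Prod.mk_eq_zero, Ideal.Quotient.eq_zero_iff_mem, Ideal.Quotient.eq_zero_iff_mem,
      Ideal.mem_span_singleton, Ideal.mem_span_singleton]
    exact ⟨dvd_mul_right _ _, dvd_mul_left _ _⟩

theorem exists_mk_eq_linear (α : A19 k) : ∃ a b : k, α = Ideal.Quotient.mk _ (C a + C b * X) := by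
  obtain ⟨p, rfl⟩ := Ideal.Quotient.mk_surjective α
  obtain ⟨q, hq⟩ := X_sub_C_dvd_sub_C_eval (a := (0 : k)) (p := p)
  obtain ⟨r, hr⟩ := X_sub_C_dvd_sub_C_eval (a := (0 : k)) (p := q)
  rw [C_0] at hq hr
  refine ⟨p.eval 0, q.eval 0, (Ideal.Quotient.mk_eq_mk_iff_sub_mem _ _).mpr
    (Ideal.mem_span_singleton.mpr ⟨r, ?_⟩)⟩
  linear_combination hq + X * hr

variable {i : A19 k →ₐ[k] B19 k}
  (hi : i (Ideal.Quotient.mk _ (X : k[X])) =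
    (Ideal.Quotient.mk _ (X : k[X]), Ideal.Quotient.mk _ ((X : k[X]) - 1)))
include hi

theorem map_mk_linear (a b : k) : i (Ideal.Quotient.mk _ (C a + C b * X)) =
    (Ideal.Quotient.mk _ (C a + C b * X), Ideal.Quotient.mk _ (C a + C b * (X - 1))) := by
  have hC (c : k) : i (Ideal.Quotient.mk _ (C c)) =
      (Ideal.Quotient.mk _ (C c), Ideal.Quotient.mk _ (C c)) := i.commutes c
  rw [map_add, map_mul, map_add, map_mul, hC, hC, hi]
  simp

theorem fst_map_eq (α : A19 k) : (i α).1 = α := by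
  obtain ⟨a, b, rfl⟩ := exists_mk_eq_linear α
  rw [map_mk_linear hi]

variable {π : D19 k →+* B19 k}
  (hπ : ∀ p, π (algebraMap k[X] (D19 k) p) = (Ideal.Quotient.mk _ p, Ideal.Quotient.mk _ p))
include hπ

theorem map_mk_linear_eq_map_iff {a b : k} {d : D19 k} :
    i (Ideal.Quotient.mk _ (C a + C b * X)) = π d ↔ ∃ e,
      d = algebraMap k (D19 k) a + algebraMap k (D19 k) b * (algebraMap k[X] (D19 k) X *
          (algebraMap k[X] (D19 k) X - 1) * (2 * algebraMap k[X] (D19 k) X - 1))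
        + algebraMap k[X] (D19 k) X ^ 2 * (algebraMap k[X] (D19 k) X - 1) ^ 2 * e := by
  have hlin : i (Ideal.Quotient.mk _ (C a + C b * X)) =
      π (algebraMap k[X] (D19 k) (C a + C b * (X * (X - 1) * (2 * X - 1)))) := by
    rw [map_mk_linear hi, hπ, Prod.mk.injEq, Ideal.Quotient.mk_eq_mk_iff_sub_mem,
      Ideal.Quotient.mk_eq_mk_iff_sub_mem, Ideal.mem_span_singleton, Ideal.mem_span_singleton]
    exact ⟨⟨C b * (3 - 2 * X), by ring⟩, ⟨-C b * (2 * X + 1), by ring⟩⟩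
  rw [hlin, eq_comm, ← sub_eq_zero, ← map_sub, map_eq_zero_iff_dvd hπ]
  simp only [sub_eq_iff_eq_add', map_add, map_mul, map_sub, map_one, map_ofNat,
    ← algebraMap_D19_eq]

theorem isTacnode_of_eq_eqLocus {R : Subring (A19 k × D19 k)} (hR : R = RingHom.eqLocus
    ((i : A19 k →+* B19 k).comp (RingHom.fst (A19 k) (D19 k)))
    (π.comp (RingHom.snd (A19 k) (D19 k)))) :
    IsTacnode k (algebraMap k[X] (D19 k) X)
      ((RingHom.snd (A19 k) (D19 k)).comp R.subtype) where
  decomp := decomp_D19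
  not_isUnit_left := by simp [isUnit_algebraMap_iff, mem_S19_iff]
  not_isUnit_right := by
    rw [← map_one (algebraMap k[X] (D19 k)), ← map_sub, isUnit_algebraMap_iff]
    simp [mem_S19_iff]
  isUnit_one_add := isUnit_one_add_D19
  dvd_pow d := dvd_pow_D19
  injective := by
    refine (injective_iff_map_eq_zero _).mpr ?_
    rintro ⟨⟨α, d⟩, hα⟩ (rfl : d = 0)
    rw [hR] at hα
    have hα0 : i α = 0 := Eq.trans hα (map_zero π)
    have : α = 0 := by rw [← fst_map_eq hi α, hα0, Prod.fst_zero]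
    subst this
    rfl
  mem_range d := by
    constructor
    · rintro ⟨⟨⟨α, d⟩, hα⟩, rfl⟩
      rw [hR] at hα
      obtain ⟨a, b, rfl⟩ := exists_mk_eq_linear α
      exact ⟨a, b, (map_mk_linear_eq_map_iff hi hπ).mp hα⟩
    · rintro ⟨a, b, hd⟩
      refine ⟨⟨(Ideal.Quotient.mk _ (C a + C b * X), d), ?_⟩, rfl⟩
      rw [hR]
      exact (map_mk_linear_eq_map_iff hi hπ).mpr hd

end

/-- Let `R` be the pullback of `i : k[T]/(T²) → k[X]/(X²) × k[X]/(X-1)²`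
(the `k`-algebra map sending `t` to `(x, x-1)`) and the canonical surjection
`π : D → D/(X²(X-1)²) ≅ k[X]/(X²) × k[X]/(X-1)²`, where `D = k[X]_{(X)∪(X-1)}`.  Then `R`
is a one-dimensional Gorenstein Noetherian local domain, its integral closure is `D`
(the projection `R → D` is injective, `D` is integral over `R`, contained in the fraction
field of `R`, and integrally closed), `E = End_R(m) = {α ∈ Frac R : α·m ⊆ m}` is local with
residue field `k` (every element of `E` is congruent to an element of `R` modulo the
nonunits of `E`), but `D` is not local. -/
theorem stmt19 (i : A19 k →ₐ[k] B19 k)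
    (hi : i (Ideal.Quotient.mk _ (X : Polynomial k)) =
      (Ideal.Quotient.mk _ (X : Polynomial k), Ideal.Quotient.mk _ ((X : Polynomial k) - 1)))
    (pi : D19 k →+* B19 k)
    (hpi : ∀ p : Polynomial k, pi (algebraMap (Polynomial k) (D19 k) p) =
      (Ideal.Quotient.mk _ p, Ideal.Quotient.mk _ p))
    (R : Subring (A19 k × D19 k))
    (hR : R = RingHom.eqLocus
      ((i : A19 k →+* B19 k).comp (RingHom.fst (A19 k) (D19 k)))
      (pi.comp (RingHom.snd (A19 k) (D19 k)))) :
    -- R is a one-dimensional Gorenstein (Noetherian) local domain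
    IsDomain R ∧ IsNoetherianRing R ∧ IsLocalRing R ∧ ringKrullDim R = 1 ∧
    (∃ (I₀ I₁ : Type u) (_ : AddCommGroup I₀) (_ : Module R I₀) (_ : AddCommGroup I₁)
      (_ : Module R I₁), Module.Injective R I₀ ∧ Module.Injective R I₁ ∧
      ∃ (f : R →ₗ[R] I₀) (g : I₀ →ₗ[R] I₁),
        Function.Injective f ∧ Function.Surjective g ∧
          LinearMap.range f = LinearMap.ker g) ∧
    -- D is the integral closure of R (in the fraction field of R):
    (Function.Injective ((RingHom.snd (A19 k) (D19 k)).comp R.subtype)) ∧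
    (∀ d : D19 k, ∃ p : Polynomial R, p.Monic ∧
      Polynomial.eval₂ ((RingHom.snd (A19 k) (D19 k)).comp R.subtype) d p = 0) ∧
    (∀ d : D19 k, ∃ r s : R, s ≠ 0 ∧
      d * ((RingHom.snd (A19 k) (D19 k)).comp R.subtype) s =
        ((RingHom.snd (A19 k) (D19 k)).comp R.subtype) r) ∧
    IsIntegrallyClosed (D19 k) ∧
    -- E = End_R(m) = {α ∈ Frac R : α·m ⊆ m} is local with residue field k:
    (∀ α β : FractionRing R,
      α ∈ {α : FractionRing R | ∀ x ∈ nonunits R,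
          α * algebraMap R (FractionRing R) x ∈
            algebraMap R (FractionRing R) '' (nonunits R)} →
      β ∈ {α : FractionRing R | ∀ x ∈ nonunits R,
          α * algebraMap R (FractionRing R) x ∈
            algebraMap R (FractionRing R) '' (nonunits R)} →
      (¬ ∃ γ ∈ {α : FractionRing R | ∀ x ∈ nonunits R,
          α * algebraMap R (FractionRing R) x ∈
            algebraMap R (FractionRing R) '' (nonunits R)}, α * γ = 1) →
      (¬ ∃ γ ∈ {α : FractionRing R | ∀ x ∈ nonunits R,
          α * algebraMap R (FractionRing R) x ∈
            algebraMap R (FractionRing R) '' (nonunits R)}, β * γ = 1) →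
      ¬ ∃ γ ∈ {α : FractionRing R | ∀ x ∈ nonunits R,
          α * algebraMap R (FractionRing R) x ∈
            algebraMap R (FractionRing R) '' (nonunits R)}, (α + β) * γ = 1) ∧
    (∀ α : FractionRing R,
      α ∈ {α : FractionRing R | ∀ x ∈ nonunits R,
          α * algebraMap R (FractionRing R) x ∈
            algebraMap R (FractionRing R) '' (nonunits R)} →
      ∃ r : R, (α - algebraMap R (FractionRing R) r) ∈
          {α : FractionRing R | ∀ x ∈ nonunits R,
            α * algebraMap R (FractionRing R) x ∈
              algebraMap R (FractionRing R) '' (nonunits R)} ∧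
        ¬ ∃ γ ∈ {α : FractionRing R | ∀ x ∈ nonunits R,
            α * algebraMap R (FractionRing R) x ∈
              algebraMap R (FractionRing R) '' (nonunits R)},
          (α - algebraMap R (FractionRing R) r) * γ = 1) ∧
    -- but D is not local:
    ¬ IsLocalRing (D19 k) := by
  have h := isTacnode_of_eq_eqLocus hi hpi hR
  have hdom : IsDomain R := h.isDomain
  have hloc : IsLocalRing R := h.isLocalRing
  obtain ⟨j, hj, hjφ⟩ := h.exists_lift (K := FractionRing R)
  refine ⟨hdom, h.isNoetherianRing, hloc, h.ringKrullDim_eq_one,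
    ⟨FractionRing R, FractionRing R ⧸ LinearMap.range (Algebra.linearMap R (FractionRing R)),
      inferInstance, inferInstance, inferInstance, inferInstance,
      Module.Baer.of_isFractionRing.injective, h.baer_quotient.injective,
      Algebra.linearMap R (FractionRing R), Submodule.mkQ _,
      FaithfulSMul.algebraMap_injective R (FractionRing R), Submodule.mkQ_surjective _,
      (Submodule.ker_mkQ _).symm⟩,
    h.injective, h.isIntegral, h.exists_mul_map_eq_map,
    isIntegrallyClosed_of_isLocalization _ (S19 k) (S19_le_nonZeroDivisors k), ?_, ?_,
    not_isLocalRing_D19⟩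
  · intro α β hα hβ hα' hβ'
    obtain ⟨a, d, rfl⟩ := (h.mem_endomorphisms_iff hj hjφ).mp hα
    obtain ⟨b, e, rfl⟩ := (h.mem_endomorphisms_iff hj hjφ).mp hβ
    rw [h.exists_inverse_iff hj hjφ, not_not] at hα' hβ'
    rw [← map_add, add_add_add_comm, ← map_add, ← mul_add, h.exists_inverse_iff hj hjφ, hα', hβ',
      add_zero, not_not]
  · intro α hα
    obtain ⟨a, d, rfl⟩ := (h.mem_endomorphisms_iff hj hjφ).mp hα
    obtain ⟨r, hr⟩ := h.exists_map_eq a 0 0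
    rw [map_zero, zero_mul, mul_zero, add_zero, add_zero] at hr
    have hsub : j (algebraMap k (D19 k) a + algebraMap k[X] (D19 k) X *
          (algebraMap k[X] (D19 k) X - 1) * d) - algebraMap R (FractionRing R) r =
        j (algebraMap k (D19 k) 0 + algebraMap k[X] (D19 k) X *
          (algebraMap k[X] (D19 k) X - 1) * d) := by
      rw [← hjφ, hr, ← map_sub, map_zero]
      congr 1
      ring
    refine ⟨r, ?_, ?_⟩
    · rw [hsub]
      exact (h.mem_endomorphisms_iff hj hjφ).mpr ⟨0, d, rfl⟩
    · rw [hsub, h.exists_inverse_iff hj hjφ, not_not]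
end
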